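/- arXiv:math/0203125 — 6 statements merged into one kernel-verified Lean document; each statement's English description precedes it below -/
import Mathlib

section
/- Let Ψ, Ω : ℝ × ℝ² → ℝ be smooth functions with ΔΨ(t,·) = Ω(t,·) for every t, and assume Ω solves the 2D Euler equation ∂ₜΩ + {Ψ,Ω} = 0. Let λ ∈ ℂ and let φ : ℝ × ℝ² → ℂ be a smooth solution of the second Lax equation ∂ₜφ + {Ψ,φ} = 0. Then the function ψ := {Ω,φ} − λφ also solves ∂ₜψ + {Ψ,ψ} = 0 identically on ℝ × ℝ². (This is the verification of the Lax pair of the 2D Euler equation: the operator d/dt + A maps the kernel relation Lφ = λφ to itself.) -/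
/-- Partial derivative in time for a function of `(t, x)`. -/
noncomputable def pdt {X E : Type*} [NormedAddCommGroup E] [NormedSpace ℝ E]
    (f : ℝ × X → E) (q : ℝ × X) : E :=
  deriv (fun s => f (s, q.2)) q.1

/-- Partial derivative in the first spatial variable. -/
noncomputable def pdx {E : Type*} [NormedAddCommGroup E] [NormedSpace ℝ E]
    (f : ℝ × ℝ → E) (p : ℝ × ℝ) : E :=
  deriv (fun x => f (x, p.2)) p.1

/-- Partial derivative in the second spatial variable. -/
noncomputable def pdy {E : Type*} [NormedAddCommGroup E] [NormedSpace ℝ E]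
    (f : ℝ × ℝ → E) (p : ℝ × ℝ) : E :=
  deriv (fun y => f (p.1, y)) p.2

/-- The bracket `{f,g} = (∂ₓf)(∂_y g) − (∂_y f)(∂ₓ g)`. -/
noncomputable def bracket {𝕜 : Type*} [NormedCommRing 𝕜] [NormedSpace ℝ 𝕜]
    (f g : ℝ × ℝ → 𝕜) (p : ℝ × ℝ) : 𝕜 :=
  pdx f p * pdy g p - pdy f p * pdx g p

open scoped ContDiff

noncomputable def dd (v : ℝ × (ℝ × ℝ)) (f : ℝ × (ℝ × ℝ) → ℂ) : ℝ × (ℝ × ℝ) → ℂ :=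
  fun q => fderiv ℝ f q v

lemma dd_smooth (v) {f : ℝ × (ℝ × ℝ) → ℂ} (hf : ContDiff ℝ ∞ f) : ContDiff ℝ ∞ (dd v f) := by
  unfold dd
  exact (hf.fderiv_right (m := ∞) (by simp)).clm_apply contDiff_const

lemma smooth_diff {f : ℝ × (ℝ × ℝ) → ℂ} (hf : ContDiff ℝ ∞ f) : Differentiable ℝ f :=
  hf.differentiable (by simp)

lemma smooth_mul {f g : ℝ × (ℝ × ℝ) → ℂ} (hf : ContDiff ℝ ∞ f) (hg : ContDiff ℝ ∞ g) :
    ContDiff ℝ ∞ (f * g) := hf.mul hg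

lemma smooth_sub {f g : ℝ × (ℝ × ℝ) → ℂ} (hf : ContDiff ℝ ∞ f) (hg : ContDiff ℝ ∞ g) :
    ContDiff ℝ ∞ (f - g) := hf.sub hg

lemma dd_mul (v) {f g : ℝ × (ℝ × ℝ) → ℂ} (hf : ContDiff ℝ ∞ f) (hg : ContDiff ℝ ∞ g) (q) :
    dd v (f * g) q = f q * dd v g q + dd v f q * g q := by
  unfold dd
  rw [fderiv_mul (smooth_diff hf q) (smooth_diff hg q)]
  simp [mul_comm]

lemma dd_sub (v) {f g : ℝ × (ℝ × ℝ) → ℂ} (hf : ContDiff ℝ ∞ f) (hg : ContDiff ℝ ∞ g) (q) :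
    dd v (f - g) q = dd v f q - dd v g q := by
  unfold dd
  rw [fderiv_sub (smooth_diff hf q) (smooth_diff hg q)]
  simp

lemma dd_const_mul (v) (c : ℂ) {f : ℝ × (ℝ × ℝ) → ℂ} (hf : ContDiff ℝ ∞ f) (q) :
    dd v (fun q => c * f q) q = c * dd v f q := by
  unfold dd
  rw [fderiv_const_mul (smooth_diff hf q)]
  simp

lemma dd_comm (v w) {f : ℝ × (ℝ × ℝ) → ℂ} (hf : ContDiff ℝ ∞ f) (q) :
    dd v (dd w f) q = dd w (dd v f) q := by
  have hd : Differentiable ℝ (fderiv ℝ f) :=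
    (hf.fderiv_right (m := ∞) (by simp)).differentiable (by simp)
  have key : ∀ a b, dd a (dd b f) q = fderiv ℝ (fderiv ℝ f) q a b := by
    intro a b
    unfold dd
    rw [fderiv_clm_apply (hd q) (differentiableAt_const _)]
    simp
  rw [key, key]
  exact (hf.contDiffAt.isSymmSndFDerivAt (by simp; exact WithTop.coe_le_coe.2 (le_top : (2 : ℕ∞) ≤ ⊤))).eq v w

lemma pdt_eq {f : ℝ × (ℝ × ℝ) → ℂ} (hf : ContDiff ℝ ∞ f) (t p) :
    pdt f (t, p) = dd (1, 0) f (t, p) := by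
  unfold pdt dd
  have h : HasDerivAt (fun s : ℝ => (s, p)) ((1 : ℝ), (0 : ℝ × ℝ)) t :=
    (hasDerivAt_id t).prodMk (hasDerivAt_const t p)
  exact ((smooth_diff hf (t, p)).hasFDerivAt.comp_hasDerivAt t h).deriv

lemma pdx_eq {f : ℝ × (ℝ × ℝ) → ℂ} (hf : ContDiff ℝ ∞ f) (t p) :
    pdx (fun q => f (t, q)) p = dd (0, (1, 0)) f (t, p) := by
  unfold pdx dd
  have h : HasDerivAt (fun s : ℝ => (t, (s, p.2))) ((0 : ℝ), ((1 : ℝ), (0 : ℝ))) p.1 :=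
    (hasDerivAt_const _ t).prodMk ((hasDerivAt_id p.1).prodMk (hasDerivAt_const _ p.2))
  exact ((smooth_diff hf (t, p)).hasFDerivAt.comp_hasDerivAt p.1 h).deriv

lemma pdy_eq {f : ℝ × (ℝ × ℝ) → ℂ} (hf : ContDiff ℝ ∞ f) (t p) :
    pdy (fun q => f (t, q)) p = dd (0, (0, 1)) f (t, p) := by
  unfold pdy dd
  have h : HasDerivAt (fun s : ℝ => (t, (p.1, s))) ((0 : ℝ), ((0 : ℝ), (1 : ℝ))) p.2 :=
    (hasDerivAt_const _ t).prodMk ((hasDerivAt_const _ p.1).prodMk (hasDerivAt_id p.2))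
  exact ((smooth_diff hf (t, p)).hasFDerivAt.comp_hasDerivAt p.2 h).deriv

lemma bracket_eq {f g : ℝ × (ℝ × ℝ) → ℂ} (hf : ContDiff ℝ ∞ f) (hg : ContDiff ℝ ∞ g) (t p) :
    bracket (fun q => f (t, q)) (fun q => g (t, q)) p =
      (dd (0, (1, 0)) f * dd (0, (0, 1)) g - dd (0, (0, 1)) f * dd (0, (1, 0)) g) (t, p) := by
  unfold bracket
  rw [pdx_eq hf, pdx_eq hg, pdy_eq hf, pdy_eq hg]
  rfl

lemma deriv_cast {f : ℝ → ℝ} {x : ℝ} (hf : DifferentiableAt ℝ f x) :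
    deriv (fun s => (f s : ℂ)) x = ((deriv f x : ℝ) : ℂ) :=
  hf.hasDerivAt.ofReal_comp.deriv

/-- Verification of the Lax pair of the 2D Euler equation: if `φ` solves the second
Lax equation, then `ψ := {Ω, φ} − λ φ` solves the transport equation `∂ₜψ + {Ψ, ψ} = 0`. -/
theorem laxPair_2d_verification
    (Ψ Ω : ℝ × (ℝ × ℝ) → ℝ)
    (hΨ : ContDiff ℝ (⊤ : ℕ∞) Ψ) (hΩ : ContDiff ℝ (⊤ : ℕ∞) Ω)
    (hlap : ∀ t p, pdx (pdx (fun q => Ψ (t, q))) p + pdy (pdy (fun q => Ψ (t, q))) p = Ω (t, p))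
    (heuler : ∀ t p,
      pdt Ω (t, p) + bracket (fun q => Ψ (t, q)) (fun q => Ω (t, q)) p = 0)
    (lam : ℂ) (φ : ℝ × (ℝ × ℝ) → ℂ) (hφ : ContDiff ℝ (⊤ : ℕ∞) φ)
    (hlax : ∀ t p,
      pdt φ (t, p) + bracket (fun q => (Ψ (t, q) : ℂ)) (fun q => φ (t, q)) p = 0)
    (ψ : ℝ × (ℝ × ℝ) → ℂ)
    (hψ : ψ = fun q =>
      bracket (fun r => (Ω (q.1, r) : ℂ)) (fun r => φ (q.1, r)) q.2 - lam * φ q) :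
    ∀ t p, pdt ψ (t, p) + bracket (fun q => (Ψ (t, q) : ℂ)) (fun q => ψ (t, q)) p = 0 := by
  have hP : ContDiff ℝ ∞ (fun q => (Ψ q : ℂ)) := Complex.ofRealCLM.contDiff.comp hΨ
  have hW : ContDiff ℝ ∞ (fun q => (Ω q : ℂ)) := Complex.ofRealCLM.contDiff.comp hΩ
  have dΨ : Differentiable ℝ Ψ := hΨ.differentiable (by simp)
  have dΩ : Differentiable ℝ Ω := hΩ.differentiable (by simp)
  have heuler' : ∀ t p, pdt (fun q => (Ω q : ℂ)) (t, p) +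
      bracket (fun q => (Ψ (t, q) : ℂ)) (fun q => (Ω (t, q) : ℂ)) p = 0 := by
    intro t p
    have h := congrArg (fun r : ℝ => (r : ℂ)) (heuler t p)
    simp only [pdt, bracket, pdx, pdy] at h ⊢
    rw [deriv_cast (by fun_prop), deriv_cast (by fun_prop), deriv_cast (by fun_prop),
      deriv_cast (by fun_prop), deriv_cast (by fun_prop)]
    exact_mod_cast h
  clear heuler hlap
  generalize hPe : (fun q => (Ψ q : ℂ)) = P at hP
  generalize hWe : (fun q => (Ω q : ℂ)) = W at hW heuler'
  have eP : ∀ q, (Ψ q : ℂ) = P q := fun q => congrFun hPe q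
  have eW : ∀ q, (Ω q : ℂ) = W q := fun q => congrFun hWe q
  simp only [eP, eW] at *
  set e1 : ℝ × (ℝ × ℝ) := (0, (1, 0)) with he1
  set e2 : ℝ × (ℝ × ℝ) := (0, (0, 1)) with he2
  have s := fun v {f} hf => @dd_smooth v f hf
  have E : dd (1, 0) W = dd e2 P * dd e1 W - dd e1 P * dd e2 W := by
    funext ⟨t, p⟩
    have h := heuler' t p
    rw [pdt_eq hW, bracket_eq hP hW] at h
    simp only [Pi.sub_apply, Pi.mul_apply] at h ⊢
    linear_combination h
  have F : dd (1, 0) φ = dd e2 P * dd e1 φ - dd e1 P * dd e2 φ := by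
    funext ⟨t, p⟩
    have h := hlax t p
    rw [pdt_eq hφ, bracket_eq hP hφ] at h
    simp only [Pi.sub_apply, Pi.mul_apply] at h ⊢
    linear_combination h
  have hψ' : ψ = (dd e1 W * dd e2 φ - dd e2 W * dd e1 φ) - (fun q => lam * φ q) := by
    rw [hψ]
    funext ⟨t, p⟩
    simp only [bracket_eq hW hφ]
    rfl
  have m1 := smooth_mul (s e1 hW) (s e2 hφ)
  have m2 := smooth_mul (s e2 hW) (s e1 hφ)
  have m3 : ContDiff ℝ ∞ (fun q => lam * φ q) := contDiff_const.mul hφ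
  have hs : ContDiff ℝ ∞ ψ := by
    rw [hψ']
    exact (smooth_sub m1 m2).sub m3
  have D : ∀ v q, dd v ψ q = (dd e1 W q * dd v (dd e2 φ) q + dd v (dd e1 W) q * dd e2 φ q)
      - (dd e2 W q * dd v (dd e1 φ) q + dd v (dd e2 W) q * dd e1 φ q) - lam * dd v φ q := by
    intro v q
    rw [hψ', dd_sub v (smooth_sub m1 m2) m3, dd_sub v m1 m2, dd_mul v (s e1 hW) (s e2 hφ),
      dd_mul v (s e2 hW) (s e1 hφ), dd_const_mul v lam hφ]
  have G : ∀ {f}, ContDiff ℝ ∞ f → ∀ v q, dd v (dd e2 P * dd e1 f - dd e1 P * dd e2 f) q =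
      (dd e2 P q * dd v (dd e1 f) q + dd v (dd e2 P) q * dd e1 f q)
      - (dd e1 P q * dd v (dd e2 f) q + dd v (dd e1 P) q * dd e2 f q) := by
    intro f hf v q
    rw [dd_sub v (smooth_mul (s e2 hP) (s e1 hf)) (smooth_mul (s e1 hP) (s e2 hf)),
      dd_mul v (s e2 hP) (s e1 hf), dd_mul v (s e1 hP) (s e2 hf)]
  intro t p
  rw [pdt_eq hs, bracket_eq hP hs]
  simp only [Pi.sub_apply, Pi.mul_apply, ← he1, ← he2]
  rw [D, D, D, dd_comm (1, 0) e1 hW, dd_comm (1, 0) e2 hW, dd_comm (1, 0) e1 hφ,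
    dd_comm (1, 0) e2 hφ, E, F, G hW, G hW, G hφ, G hφ, dd_comm e2 e1 hW, dd_comm e2 e1 hφ,
    dd_comm e2 e1 hP]
  simp only [Pi.sub_apply, Pi.mul_apply]
  ring
end

section
/- Let Ω : ℝ² → ℝ be a smooth ℤ²-periodic function which is not identically constant. Then every purely imaginary number is an approximate eigenvalue of the operator Lφ = {Ω,φ} on L²(T²): for every μ ∈ ℝ there exists a sequence of smooth ℤ²-periodic functions φₙ : ℝ² → ℂ with ∫_{[0,1]×[0,1]} |φₙ|² = 1 for all n and ∫_{[0,1]×[0,1]} |{Ω,φₙ} − iμ·φₙ|² → 0 as n → ∞. (This expresses the inclusion iℝ ⊂ σ_{L²(T²)}(L) in the paper's theorem that σ_{L²(T²)}(L) = iℝ for nonconstant Ω.) -/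
open MeasureTheory Filter

/-- The Hamiltonian vector field. -/
noncomputable def XX (Ω : ℝ × ℝ → ℝ) (z : ℝ × ℝ) : ℝ × ℝ :=
  (-(fderiv ℝ Ω z (0, 1)), fderiv ℝ Ω z (1, 0))

lemma pdx_eq_s6 {E : Type*} [NormedAddCommGroup E] [NormedSpace ℝ E]
    {f : ℝ × ℝ → E} {p : ℝ × ℝ} (hf : DifferentiableAt ℝ f p) :
    pdx f p = fderiv ℝ f p (1, 0) := by
  unfold pdx
  have h1 : HasDerivAt (fun x : ℝ => (x, p.2)) ((1 : ℝ), (0 : ℝ)) p.1 :=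
    (hasDerivAt_id p.1).prodMk (hasDerivAt_const _ _)
  have h2 : HasFDerivAt f (fderiv ℝ f p) ((fun x : ℝ => (x, p.2)) p.1) := hf.hasFDerivAt
  exact (h2.comp_hasDerivAt p.1 h1).deriv

lemma pdy_eq_s6 {E : Type*} [NormedAddCommGroup E] [NormedSpace ℝ E]
    {f : ℝ × ℝ → E} {p : ℝ × ℝ} (hf : DifferentiableAt ℝ f p) :
    pdy f p = fderiv ℝ f p (0, 1) := by
  unfold pdy
  have h1 : HasDerivAt (fun x : ℝ => (p.1, x)) ((0 : ℝ), (1 : ℝ)) p.2 :=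
    (hasDerivAt_const _ _).prodMk (hasDerivAt_id p.2)
  have h2 : HasFDerivAt f (fderiv ℝ f p) ((fun x : ℝ => (p.1, x)) p.2) := hf.hasFDerivAt
  exact (h2.comp_hasDerivAt p.2 h1).deriv

lemma fderiv_pair {E : Type*} [NormedAddCommGroup E] [NormedSpace ℝ E]
    (L : ℝ × ℝ →L[ℝ] E) (a b : ℝ) : L (a, b) = a • L (1, 0) + b • L (0, 1) := by
  rw [← map_smul, ← map_smul, ← map_add]; simp

lemma bracket_eq_s6 {Ω : ℝ × ℝ → ℝ} {φ : ℝ × ℝ → ℂ} {p : ℝ × ℝ}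
    (hΩ : DifferentiableAt ℝ Ω p) (hφ : DifferentiableAt ℝ φ p) :
    bracket (fun r => (Ω r : ℂ)) φ p = fderiv ℝ φ p (XX Ω p) := by
  have hc : HasFDerivAt (fun r => (Ω r : ℂ)) (Complex.ofRealCLM.comp (fderiv ℝ Ω p)) p :=
    Complex.ofRealCLM.hasFDerivAt.comp p hΩ.hasFDerivAt
  unfold bracket XX
  rw [pdx_eq_s6 hφ, pdy_eq_s6 hφ, pdx_eq_s6 hc.differentiableAt, pdy_eq_s6 hc.differentiableAt, hc.fderiv,
    fderiv_pair (fderiv ℝ φ p) (-(fderiv ℝ Ω p (0, 1))) (fderiv ℝ Ω p (1, 0))]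
  simp
  ring

lemma XX_contDiff {Ω : ℝ × ℝ → ℝ} (hΩ : ContDiff ℝ (⊤ : ℕ∞) Ω) :
    ContDiff ℝ (⊤ : ℕ∞) (XX Ω) := by
  have h : ContDiff ℝ (⊤ : ℕ∞) (fderiv ℝ Ω) := hΩ.fderiv_right (by simp)
  unfold XX
  fun_prop

lemma fderiv_per {E : Type*} [NormedAddCommGroup E] [NormedSpace ℝ E] {f : ℝ × ℝ → E}
    (hf : ∀ (m n : ℤ) (x y : ℝ), f (x + m, y + n) = f (x, y)) (m n : ℤ) (x y : ℝ) :
    fderiv ℝ f (x + m, y + n) = fderiv ℝ f (x, y) := by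
  have h : (fun z : ℝ × ℝ => f (z + ((m : ℝ), (n : ℝ)))) = f := by
    funext z; exact hf m n z.1 z.2
  have h2 := fderiv_comp_add_right (𝕜 := ℝ) (f := f) (x := (x, y)) ((m : ℝ), (n : ℝ))
  rw [h] at h2
  exact h2.symm

lemma XX_per {Ω : ℝ × ℝ → ℝ}
    (hf : ∀ (m n : ℤ) (x y : ℝ), Ω (x + m, y + n) = Ω (x, y)) (m n : ℤ) (x y : ℝ) :
    XX Ω (x + m, y + n) = XX Ω (x, y) := by
  unfold XX; rw [fderiv_per hf]

lemma integral_shift {h : ℝ × ℝ → ℝ} (hc : Continuous h)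
    (hper : ∀ (m n : ℤ) (x y : ℝ), h (x + m, y + n) = h (x, y)) (a b : ℝ) :
    ∫ p in Set.Icc (0 : ℝ) 1 ×ˢ Set.Icc (0 : ℝ) 1, h p =
      ∫ p in Set.Icc a (a + 1) ×ˢ Set.Icc b (b + 1), h p := by
  have key : ∀ a b : ℝ, ∫ p in Set.Icc a (a + 1) ×ˢ Set.Icc b (b + 1), h p =
      ∫ x in a..(a + 1), ∫ y in b..(b+1), h (x, y) := by
    intro a b
    rw [Measure.volume_eq_prod, setIntegral_prod]
    · rw [intervalIntegral.integral_of_le (by linarith), integral_Icc_eq_integral_Ioc]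
      congr 1
      funext x
      rw [intervalIntegral.integral_of_le (by linarith), integral_Icc_eq_integral_Ioc]
    · exact (hc.continuousOn).integrableOn_compact (isCompact_Icc.prod isCompact_Icc)
  have k0 := key 0 0
  simp only [zero_add] at k0
  rw [k0, key]
  have e1 : ∀ x, ∫ y in (0:ℝ)..1, h (x, y) = ∫ y in b..(b+1), h (x, y) := by
    intro x
    have hp : Function.Periodic (fun y => h (x, y)) 1 := by
      intro y; simpa using hper 0 1 x y
    simpa using hp.intervalIntegral_add_eq 0 b
  have hp : Function.Periodic (fun x => ∫ y in b..(b+1), h (x, y)) 1 := by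
    intro x
    simp only
    congr 1
    funext y; simpa using hper 1 0 x y
  simp only [e1]
  simpa using hp.intervalIntegral_add_eq 0 a

lemma integral_transfer {h g : ℝ × ℝ → ℝ} (hc : Continuous h)
    (hper : ∀ (m n : ℤ) (x y : ℝ), h (x + m, y + n) = h (x, y)) (x0 : ℝ × ℝ)
    (hg : ∀ z, z ∉ Metric.closedBall x0 (1/4) → g z = 0)
    (hgh : ∀ z ∈ Metric.ball x0 (1/2), h z = g z) :
    ∫ p in Set.Icc (0 : ℝ) 1 ×ˢ Set.Icc (0 : ℝ) 1, h p = ∫ p, g p := by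
  rw [integral_shift hc hper (x0.1 - 1/2) (x0.2 - 1/2)]
  have hs : Set.Icc (x0.1 - 1/2) (x0.1 - 1/2 + 1) ×ˢ Set.Icc (x0.2 - 1/2) (x0.2 - 1/2 + 1)
      = Metric.closedBall x0 (1/2) := by
    have e1 : x0.1 - 1/2 + 1 = x0.1 + 1/2 := by ring
    have e2 : x0.2 - 1/2 + 1 = x0.2 + 1/2 := by ring
    rw [e1, e2, ← Real.closedBall_eq_Icc, ← Real.closedBall_eq_Icc, closedBall_prod_same]
  rw [hs]
  have hae : (Metric.ball x0 (1/2) : Set (ℝ × ℝ)) =ᵐ[volume] Metric.closedBall x0 (1/2) := by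
    have := Measure.addHaar_sphere (volume : Measure (ℝ × ℝ)) x0 (1/2)
    rw [← Metric.ball_union_sphere]
    exact (union_ae_eq_left_of_ae_eq_empty (ae_eq_empty.2 this)).symm
  rw [← setIntegral_congr_set hae, setIntegral_congr_fun measurableSet_ball hgh]
  apply setIntegral_eq_integral_of_forall_compl_eq_zero
  intro z hz
  apply hg
  intro h
  exact hz (Metric.closedBall_subset_ball (by norm_num) h)

lemma periodize {φ : ℝ × ℝ → ℂ} (hφ : ContDiff ℝ (⊤ : ℕ∞) φ) (x0 : ℝ × ℝ)
    (hs : ∀ z, z ∉ Metric.closedBall x0 (1/4) → φ z = 0) :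
    ∃ P : ℝ × ℝ → ℂ, ContDiff ℝ (⊤ : ℕ∞) P ∧
      (∀ (m k : ℤ) (x y : ℝ), P (x + m, y + k) = P (x, y)) ∧
      ∀ z ∈ Metric.ball x0 (1/2), P z = φ z := by
  have hs' : ∀ z : ℝ × ℝ, (1/4 < |z.1 - x0.1| ∨ 1/4 < |z.2 - x0.2|) → φ z = 0 := by
    intro z hz
    apply hs
    intro hz2
    rw [Metric.mem_closedBall, Prod.dist_eq, max_le_iff, Real.dist_eq, Real.dist_eq] at hz2
    rcases hz with h | h
    · linarith [hz2.1]
    · linarith [hz2.2]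
  have rl : ∀ (x : ℝ) (m : ℤ), |x - m| < 1/2 → round x = m := by
    intro x m h
    rw [abs_lt] at h
    rw [round_eq, Int.floor_eq_iff]
    constructor <;> linarith [h.1, h.2]
  let P : ℝ × ℝ → ℂ := fun z => φ (z.1 - round (z.1 - x0.1), z.2 - round (z.2 - x0.2))
  refine ⟨P, ?_, ?_, ?_⟩
  · rw [contDiff_iff_contDiffAt]
    intro z
    by_cases h : |z.1 - x0.1 - round (z.1 - x0.1)| < 1/2 ∧ |z.2 - x0.2 - round (z.2 - x0.2)| < 1/2
    · have hsm : ContDiffAt ℝ (⊤ : ℕ∞) (fun w : ℝ × ℝ =>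
        φ (w.1 - (round (z.1 - x0.1) : ℤ), w.2 - (round (z.2 - x0.2) : ℤ))) z := by
        apply ContDiff.contDiffAt
        fun_prop
      apply hsm.congr_of_eventuallyEq
      have c1 : ∀ᶠ w : ℝ × ℝ in nhds z, |w.1 - x0.1 - round (z.1 - x0.1)| < 1/2 :=
        (by fun_prop : Continuous fun w : ℝ × ℝ => |w.1 - x0.1 - round (z.1 - x0.1)|).continuousAt.eventually_lt
          continuousAt_const h.1
      have c2 : ∀ᶠ w : ℝ × ℝ in nhds z, |w.2 - x0.2 - round (z.2 - x0.2)| < 1/2 :=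
        (by fun_prop : Continuous fun w : ℝ × ℝ => |w.2 - x0.2 - round (z.2 - x0.2)|).continuousAt.eventually_lt
          continuousAt_const h.2
      filter_upwards [c1, c2] with w h1 h2
      simp only [P]
      rw [rl _ _ h1, rl _ _ h2]
    · have hsm : ContDiffAt ℝ (⊤ : ℕ∞) (fun w : ℝ × ℝ => (0 : ℂ)) z := contDiffAt_const
      apply hsm.congr_of_eventuallyEq
      have c1 : ∀ᶠ w : ℝ × ℝ in nhds z, |w.1 - z.1| < 1/4 :=
        (by fun_prop : Continuous fun w : ℝ × ℝ => |w.1 - z.1|).continuousAt.eventually_lt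
          continuousAt_const (by simp)
      have c2 : ∀ᶠ w : ℝ × ℝ in nhds z, |w.2 - z.2| < 1/4 :=
        (by fun_prop : Continuous fun w : ℝ × ℝ => |w.2 - z.2|).continuousAt.eventually_lt
          continuousAt_const (by simp)
      have aux : ∀ x w c : ℝ, |w - x| < 1/4 → 1/2 ≤ |x - c - round (x - c)| →
          1/4 < |w - round (w - c) - c| := by
        intro x w c h1 h2
        have h3 := round_le (x - c) (round (w - c))
        have h4 : |x - c - round (w - c)| ≤ |w - round (w - c) - c| + |w - x| := by
          have : x - c - round (w - c) = (w - round (w - c) - c) - (w - x) := by ring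
          rw [this]; exact abs_sub _ _
        linarith
      filter_upwards [c1, c2] with w h1 h2
      simp only [P]
      apply hs'
      simp only
      rw [not_and_or, not_lt, not_lt] at h
      rcases h with h | h
      · left; exact aux _ _ _ h1 h
      · right; exact aux _ _ _ h2 h
  · intro m k x y
    simp only [P]
    have e1 : x + m - x0.1 = x - x0.1 + m := by ring
    have e2 : y + k - x0.2 = y - x0.2 + k := by ring
    rw [e1, e2, round_add_intCast, round_add_intCast]
    congr 2 <;> push_cast <;> ring
  · intro z hz
    rw [Metric.mem_ball, Prod.dist_eq, max_lt_iff, Real.dist_eq, Real.dist_eq] at hz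
    simp only [P]
    rw [rl (z.1 - x0.1) 0 (by simpa using hz.1), rl (z.2 - x0.2) 0 (by simpa using hz.2)]
    simp

lemma reduction (Ω : ℝ × ℝ → ℝ) (hΩ : ContDiff ℝ (⊤ : ℕ∞) Ω)
    (hΩper : ∀ (m n : ℤ) (x y : ℝ), Ω (x + m, y + n) = Ω (x, y)) (μ : ℝ)
    (H : ∀ ε > 0, ∃ (φ : ℝ × ℝ → ℂ) (x0 : ℝ × ℝ), ContDiff ℝ (⊤ : ℕ∞) φ ∧
      (∀ z, z ∉ Metric.closedBall x0 (1/4) → φ z = 0) ∧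
      0 < ∫ p, ‖φ p‖ ^ 2 ∧
      ∫ p, ‖fderiv ℝ φ p (XX Ω p) - (μ * Complex.I) * φ p‖ ^ 2 ≤ ε * ∫ p, ‖φ p‖ ^ 2) :
    ∃ φ : ℕ → ℝ × ℝ → ℂ,
      (∀ n, ContDiff ℝ (⊤ : ℕ∞) (φ n)) ∧
      (∀ n, ∀ (m k : ℤ) (x y : ℝ), φ n (x + m, y + k) = φ n (x, y)) ∧
      (∀ n, ∫ p in Set.Icc (0 : ℝ) 1 ×ˢ Set.Icc (0 : ℝ) 1, ‖φ n p‖ ^ 2 = 1) ∧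
      Tendsto
        (fun n => ∫ p in Set.Icc (0 : ℝ) 1 ×ˢ Set.Icc (0 : ℝ) 1,
          ‖bracket (fun r => (Ω r : ℂ)) (φ n) p - (μ * Complex.I) * φ n p‖ ^ 2)
        atTop (nhds 0) := by
  have H2 : ∀ ε > 0, ∃ P : ℝ × ℝ → ℂ, ContDiff ℝ (⊤ : ℕ∞) P ∧
      (∀ (m k : ℤ) (x y : ℝ), P (x + m, y + k) = P (x, y)) ∧
      (∫ p in Set.Icc (0 : ℝ) 1 ×ˢ Set.Icc (0 : ℝ) 1, ‖P p‖ ^ 2 = 1) ∧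
      ∫ p in Set.Icc (0 : ℝ) 1 ×ˢ Set.Icc (0 : ℝ) 1,
          ‖bracket (fun r => (Ω r : ℂ)) P p - (μ * Complex.I) * P p‖ ^ 2 ≤ ε := by
    intro ε hε
    obtain ⟨φ, x0, hφ, hs, hpos, hle⟩ := H ε hε
    obtain ⟨P, hP, hPper, hPeq⟩ := periodize hφ x0 hs
    set N := ∫ p, ‖φ p‖ ^ 2 with hN
    have hX := XX_contDiff hΩ
    have hfd : Continuous (fderiv ℝ P) := hP.continuous_fderiv (by simp)
    have I1 : ∫ p in Set.Icc (0 : ℝ) 1 ×ˢ Set.Icc (0 : ℝ) 1, ‖P p‖ ^ 2 = N := by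
      apply integral_transfer (x0 := x0)
      · have := hP.continuous
        fun_prop
      · intro m n x y; rw [hPper]
      · intro z hz; simp [hs z hz]
      · intro z hz; rw [hPeq z hz]
    have I2 : ∫ p in Set.Icc (0 : ℝ) 1 ×ˢ Set.Icc (0 : ℝ) 1,
        ‖fderiv ℝ P p (XX Ω p) - (μ * Complex.I) * P p‖ ^ 2 =
        ∫ p, ‖fderiv ℝ φ p (XX Ω p) - (μ * Complex.I) * φ p‖ ^ 2 := by
      apply integral_transfer (x0 := x0)
      · have h1 := hP.continuous
        have h2 : Continuous fun p => fderiv ℝ P p (XX Ω p) := hfd.clm_apply hX.continuous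
        fun_prop
      · intro m n x y; rw [hPper, fderiv_per hPper, XX_per hΩper]
      · intro z hz
        have : φ =ᶠ[nhds z] fun _ => 0 := by
          filter_upwards [Metric.isClosed_closedBall.isOpen_compl.mem_nhds hz] with w hw
          exact hs w hw
        rw [this.fderiv_eq, hs z hz]; simp
      · intro z hz
        have : P =ᶠ[nhds z] φ := by
          filter_upwards [Metric.isOpen_ball.mem_nhds hz] with w hw
          exact hPeq w hw
        rw [this.fderiv_eq, hPeq z hz]
    have hsq : 0 < Real.sqrt N := Real.sqrt_pos.2 hpos
    set c : ℝ := (Real.sqrt N)⁻¹ with hc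
    have hc2 : c ^ 2 * N = 1 := by
      rw [hc, inv_pow, Real.sq_sqrt hpos.le]; field_simp
    refine ⟨fun z => (c : ℂ) * P z, contDiff_const.mul hP, ?_, ?_, ?_⟩
    · intro m k x y; simp only; rw [hPper]
    · simp only [norm_mul, mul_pow]
      rw [integral_const_mul, I1]
      simpa using hc2
    · have hd : ∀ p, ‖bracket (fun r => (Ω r : ℂ)) (fun z => (c : ℂ) * P z) p -
          (μ * Complex.I) * ((c : ℂ) * P p)‖ ^ 2 =
          c ^ 2 * ‖fderiv ℝ P p (XX Ω p) - (μ * Complex.I) * P p‖ ^ 2 := by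
        intro p
        have hPd : DifferentiableAt ℝ P p := (hP.differentiable (by simp)) p
        rw [bracket_eq_s6 ((hΩ.differentiable (by simp)) p) (hPd.const_mul _), fderiv_const_mul hPd]
        have : ((c : ℂ) • fderiv ℝ P p) (XX Ω p) - (μ * Complex.I) * ((c : ℂ) * P p) =
          (c : ℂ) * (fderiv ℝ P p (XX Ω p) - (μ * Complex.I) * P p) := by
          simp only [smul_apply, smul_eq_mul]; ring
        rw [this, norm_mul, mul_pow]; simp
      simp only [hd]
      rw [integral_const_mul, I2]
      calc _ ≤ c ^ 2 * (ε * N) := by gcongr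
        _ = ε := by rw [mul_left_comm, hc2, mul_one]
  choose Q hQ using fun n : ℕ => H2 (1 / ((n : ℝ) + 1)) (by positivity)
  refine ⟨Q, fun n => (hQ n).1, fun n => (hQ n).2.1, fun n => (hQ n).2.2.1, ?_⟩
  refine squeeze_zero (fun n => ?_) (fun n => (hQ n).2.2.2) tendsto_one_div_add_atTop_nhds_zero_nat
  exact integral_nonneg fun p => by positivity


/-- The part of `U` mapped by `S` to the box `[-R,R]×[-1,1]`. -/
def KK (U : Set (ℝ × ℝ)) (S : ℝ × ℝ → ℝ × ℝ) (R : ℝ) : Set (ℝ × ℝ) :=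
  {z | z ∈ U ∧ S z ∈ Set.Icc (-R) R ×ˢ Set.Icc (-1 : ℝ) 1}

/-- Approximate flow boxes. -/
def FB (X : ℝ × ℝ → ℝ × ℝ) (R ε : ℝ) : Prop :=
  ∃ (x0 : ℝ × ℝ) (U : Set (ℝ × ℝ)) (S : ℝ × ℝ → ℝ × ℝ) (J : ℝ),
    IsOpen U ∧ ContDiffOn ℝ (⊤ : ℕ∞) S U ∧ Set.InjOn S U ∧ 0 < J ∧
    (∀ z ∈ U, |(fderiv ℝ S z).det| = J) ∧
    Set.Icc (-R) R ×ˢ Set.Icc (-1 : ℝ) 1 ⊆ S '' U ∧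
    IsClosed (KK U S R) ∧ KK U S R ⊆ Metric.closedBall x0 (1/4) ∧
    ∀ z ∈ KK U S R, ‖fderiv ℝ S z (X z) - (1, 0)‖ ≤ ε

/-- bump -/
noncomputable def bp (t : ℝ) : ℝ := expNegInvGlue (1 - t ^ 2)

lemma bp_contDiff : ContDiff ℝ (⊤ : ℕ∞) bp := by
  unfold bp
  exact expNegInvGlue.contDiff.comp (by fun_prop)

lemma bp_zero {t : ℝ} (h : 1 ≤ |t|) : bp t = 0 := by
  apply expNegInvGlue.zero_of_nonpos
  have : 1 ≤ t ^ 2 := by rw [← sq_abs]; nlinarith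
  linarith

lemma bp_bound : ∃ C : ℝ, 0 < C ∧ ∀ t : ℝ, |t| ≤ 1 → |bp t| ≤ C ∧ |deriv bp t| ≤ C := by
  have h1 : Continuous bp := bp_contDiff.continuous
  have h2 : Continuous (deriv bp) := bp_contDiff.continuous_deriv (by simp)
  obtain ⟨C1, hC1⟩ := (isCompact_Icc (a := (-1:ℝ)) (b := 1)).exists_bound_of_continuousOn h1.continuousOn
  obtain ⟨C2, hC2⟩ := (isCompact_Icc (a := (-1:ℝ)) (b := 1)).exists_bound_of_continuousOn h2.continuousOn
  refine ⟨max 1 (max C1 C2), by positivity, fun t ht => ?_⟩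
  have ht' : t ∈ Set.Icc (-1:ℝ) 1 := abs_le.1 ht
  exact ⟨(hC1 t ht').trans ((le_max_left _ _).trans (le_max_right _ _)),
    (hC2 t ht').trans ((le_max_right _ _).trans (le_max_right _ _))⟩

lemma bp_int : 0 < ∫ t, bp t ^ 2 := by
  have h1 : Continuous bp := bp_contDiff.continuous
  apply Continuous.integral_pos_of_hasCompactSupport_nonneg_nonzero (x := 0)
  · fun_prop
  · apply HasCompactSupport.intro (K := Set.Icc (-1) 1) isCompact_Icc
    intro x hx
    rw [bp_zero]; · simp
    by_contra h
    exact hx (abs_le.1 (not_le.1 h).le)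
  · intro x; positivity
  · have : 0 < bp 0 := expNegInvGlue.pos_of_pos (by norm_num)
    positivity

/-- model function -/
noncomputable def psi (μ R : ℝ) (w : ℝ × ℝ) : ℂ :=
  Complex.exp ((μ * w.1 : ℝ) * Complex.I) * ((bp (w.1 / R) * bp w.2 : ℝ) : ℂ)

lemma psi_contDiff (μ R : ℝ) : ContDiff ℝ (⊤ : ℕ∞) (psi μ R) := by
  unfold psi
  apply ContDiff.mul
  · apply ContDiff.cexp
    apply ContDiff.mul _ contDiff_const
    exact Complex.ofRealCLM.contDiff.comp (contDiff_const.mul contDiff_fst)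
  · apply Complex.ofRealCLM.contDiff.comp
    apply ContDiff.mul
    · exact bp_contDiff.comp (by fun_prop)
    · exact bp_contDiff.comp (by fun_prop)

lemma psi_norm (μ R : ℝ) (w : ℝ × ℝ) : ‖psi μ R w‖ ^ 2 = bp (w.1 / R) ^ 2 * bp w.2 ^ 2 := by
  unfold psi
  rw [norm_mul, Complex.norm_exp_ofReal_mul_I, Complex.norm_real, one_mul, Real.norm_eq_abs, sq_abs,
    mul_pow]

lemma psi_zero {μ R : ℝ} (hR : 0 < R) {w : ℝ × ℝ} (hw : w ∉ Set.Icc (-R) R ×ˢ Set.Icc (-1 : ℝ) 1) :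
    psi μ R w = 0 := by
  have : bp (w.1 / R) * bp w.2 = 0 := by
    by_contra h
    apply hw
    rw [mul_eq_zero, not_or] at h
    have h1 : |w.1 / R| ≤ 1 := by
      by_contra h'; exact h.1 (bp_zero (not_le.1 h').le)
    have h2 : |w.2| ≤ 1 := by
      by_contra h'; exact h.2 (bp_zero (not_le.1 h').le)
    rw [abs_div, abs_of_pos hR, div_le_one hR] at h1
    exact ⟨abs_le.1 h1, abs_le.1 h2⟩
  unfold psi
  rw [this]; simp

lemma psi_int (μ : ℝ) {R : ℝ} (hR : 0 < R) :
    ∫ w, ‖psi μ R w‖ ^ 2 = R * (∫ t, bp t ^ 2) ^ 2 := by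
  simp only [psi_norm]
  rw [Measure.volume_eq_prod, integral_prod_mul (fun s => bp (s / R) ^ 2) (fun t => bp t ^ 2),
    Measure.integral_comp_div (fun s => bp s ^ 2) R, abs_of_pos hR, smul_eq_mul]
  ring

lemma psi_deriv {μ R C : ℝ} (hR : 1 ≤ R) (hC : 0 < C)
    (hb : ∀ t : ℝ, |t| ≤ 1 → |bp t| ≤ C ∧ |deriv bp t| ≤ C)
    {w : ℝ × ℝ} (hw : w ∈ Set.Icc (-R) R ×ˢ Set.Icc (-1 : ℝ) 1) {v : ℝ × ℝ}
    (hv : ‖v - (1, 0)‖ ≤ 1 / R) :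
    ‖fderiv ℝ (psi μ R) w v - (μ * Complex.I) * psi μ R w‖ ≤ C ^ 2 * (|μ| + 3) / R := by
  have hR0 : 0 < R := by linarith
  have hd : DifferentiableAt ℝ (psi μ R) w := (psi_contDiff μ R).differentiable (by simp) w
  have hbd : ∀ t, HasDerivAt bp (deriv bp t) t := fun t =>
    ((bp_contDiff.differentiable (by simp)) t).hasDerivAt
  set s := w.1 with hs
  set t := w.2 with ht
  set e : ℂ := Complex.exp ((μ * s : ℝ) * Complex.I) with he
  have hen : ‖e‖ = 1 := Complex.norm_exp_ofReal_mul_I _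
  have d1 : fderiv ℝ (psi μ R) w (1, 0) =
      e * (μ * Complex.I) * ((bp (s / R) * bp t : ℝ) : ℂ) + e * ((deriv bp (s/R) * (1 / R) * bp t : ℝ) : ℂ) := by
    rw [← pdx_eq_s6 hd]
    apply HasDerivAt.deriv
    unfold psi
    apply HasDerivAt.mul
    · have h1 : HasDerivAt (fun x : ℝ => ((μ * x : ℝ) : ℂ) * Complex.I) ((μ : ℂ) * Complex.I) s := by
        apply HasDerivAt.mul_const
        have : HasDerivAt (fun x : ℝ => μ * x) μ s := by simpa using (hasDerivAt_id s).const_mul μ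
        exact this.ofReal_comp
      exact h1.cexp
    · apply HasDerivAt.ofReal_comp
      show HasDerivAt (fun y => bp (y / R) * bp t) (deriv bp (s / R) * (1 / R) * bp t) s
      apply HasDerivAt.mul_const
      exact HasDerivAt.comp (h₂ := bp) (h := fun y => y / R) s (hbd (s / R)) ((hasDerivAt_id s).div_const R)
  have d2 : fderiv ℝ (psi μ R) w (0, 1) = e * ((bp (s / R) * deriv bp t : ℝ) : ℂ) := by
    rw [← pdy_eq_s6 hd]
    apply HasDerivAt.deriv
    unfold psi
    show HasDerivAt (fun y => e * ((bp (s / R) * bp y : ℝ) : ℂ)) (e * ((bp (s / R) * deriv bp t : ℝ) : ℂ)) t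
    apply HasDerivAt.const_mul
    apply HasDerivAt.ofReal_comp
    exact (hbd t).const_mul _
  obtain ⟨v1, v2⟩ := v
  have hv' : |v1 - 1| ≤ 1 / R ∧ |v2| ≤ 1 / R := by
    simpa [Prod.norm_def] using hv
  have hs1 : |s / R| ≤ 1 := by
    rw [abs_div, abs_of_pos hR0, div_le_one hR0]; exact abs_le.2 hw.1
  have ht1 : |t| ≤ 1 := abs_le.2 hw.2
  have hpsi : psi μ R w = e * ((bp (s / R) * bp t : ℝ) : ℂ) := rfl
  rw [fderiv_pair, d1, d2, hpsi]
  have eq : v1 • (e * (μ * Complex.I) * ((bp (s / R) * bp t : ℝ) : ℂ) + e * ((deriv bp (s/R) * (1 / R) * bp t : ℝ) : ℂ))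
      + v2 • (e * ((bp (s / R) * deriv bp t : ℝ) : ℂ)) - μ * Complex.I * (e * ((bp (s / R) * bp t : ℝ) : ℂ))
      = e * ((((v1 - 1) * μ * (bp (s / R) * bp t) : ℝ) : ℂ) * Complex.I
        + ((v1 * (deriv bp (s/R) * (1 / R) * bp t) : ℝ) : ℂ) + ((v2 * (bp (s / R) * deriv bp t) : ℝ) : ℂ)) := by
    simp only [Complex.real_smul]; push_cast; ring
  rw [eq, norm_mul, hen, one_mul]
  refine (norm_add₃_le).trans ?_
  rw [norm_mul, Complex.norm_I, mul_one]
  simp only [Complex.norm_real, Real.norm_eq_abs, abs_mul]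
  obtain ⟨b1, b2⟩ := hb _ hs1
  obtain ⟨b3, b4⟩ := hb _ ht1
  have hv1 : |v1| ≤ 2 := by
    have : |v1| ≤ |v1 - 1| + |1| := by simpa using abs_add_le (v1 - 1) 1
    have h3 : 1 / R ≤ 1 := by rw [div_le_one hR0]; exact hR
    rw [abs_one] at this; linarith [hv'.1]
  have hRi : |1 / R| = 1 / R := abs_of_pos (by positivity)
  rw [hRi]
  calc _ ≤ (1 / R) * |μ| * (C * C) + 2 * (C * (1 / R) * C) + (1 / R) * (C * C) := by
        gcongr
        · exact hv'.1
        · exact hv'.2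
    _ = C ^ 2 * (|μ| + 3) / R := by field_simp; ring

lemma flowbox {X : ℝ × ℝ → ℝ × ℝ} (H : ∀ R ≥ 1, FB X R (1 / R)) (μ : ℝ) :
    ∀ ε > 0, ∃ (φ : ℝ × ℝ → ℂ) (x0 : ℝ × ℝ), ContDiff ℝ (⊤ : ℕ∞) φ ∧
      (∀ z, z ∉ Metric.closedBall x0 (1/4) → φ z = 0) ∧
      0 < ∫ p, ‖φ p‖ ^ 2 ∧
      ∫ p, ‖fderiv ℝ φ p (X p) - (μ * Complex.I) * φ p‖ ^ 2 ≤ ε * ∫ p, ‖φ p‖ ^ 2 := by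
  intro ε hε
  obtain ⟨C, hC, hb⟩ := bp_bound
  have hm := bp_int
  set m := ∫ t, bp t ^ 2 with hmdef
  set D : ℝ := 4 * (C ^ 2 * (|μ| + 3)) ^ 2 / m ^ 2 with hD
  have hD0 : 0 < D := by positivity
  set R : ℝ := max 1 (D / ε) with hRdef
  have hR1 : 1 ≤ R := le_max_left _ _
  have hR0 : 0 < R := by linarith
  have hR2 : D / R ^ 2 ≤ ε := by
    have : D / ε ≤ R := le_max_right _ _
    rw [div_le_iff₀ hε] at this
    rw [div_le_iff₀ (by positivity)]
    nlinarith [mul_pos hε hR0]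
  obtain ⟨x0, U, S, J, hU, hS, hinj, hJ, hdet, hbox, hKc, hKb, hKX⟩ := H R hR1
  set B := Set.Icc (-R) R ×ˢ Set.Icc (-1 : ℝ) 1 with hB
  set K := KK U S R with hK
  have hKU : K ⊆ U := fun z hz => hz.1
  classical
  let φ : ℝ × ℝ → ℂ := fun z => if z ∈ K then psi μ R (S z) else 0
  have hφU : ∀ z ∈ U, φ z = psi μ R (S z) := by
    intro z hz
    by_cases h : z ∈ K
    · simp [φ, h]
    · simp only [φ, h, if_false]
      rw [psi_zero hR0]
      intro h'; exact h ⟨hz, h'⟩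
  have hφK : ∀ z, z ∉ K → φ z = 0 := fun z hz => by simp [φ, hz]
  have hφK' : ∀ z, z ∉ K → φ =ᶠ[nhds z] fun _ => 0 := by
    intro z hz
    filter_upwards [hKc.isOpen_compl.mem_nhds hz] with w hw
    exact hφK w hw
  have hφU' : ∀ z ∈ U, φ =ᶠ[nhds z] (psi μ R) ∘ S := by
    intro z hz
    filter_upwards [hU.mem_nhds hz] with w hw
    exact hφU w hw
  have hSat : ∀ z ∈ U, ContDiffAt ℝ (⊤ : ℕ∞) S z := fun z hz => hS.contDiffAt (hU.mem_nhds hz)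
  have hφ : ContDiff ℝ (⊤ : ℕ∞) φ := by
    rw [contDiff_iff_contDiffAt]
    intro z
    by_cases h : z ∈ K
    · exact (((psi_contDiff μ R).contDiffAt).comp z (hSat z (hKU h))).congr_of_eventuallyEq
        (hφU' z (hKU h))
    · exact contDiffAt_const.congr_of_eventuallyEq (hφK' z h)
  have hSd : ∀ z ∈ U, HasFDerivAt S (fderiv ℝ S z) z := fun z hz =>
    ((hSat z hz).differentiableAt (by simp)).hasFDerivAt
  have cov : ∀ g : ℝ × ℝ → ℝ, ∫ x in S '' U, g x = J * ∫ x in U, g (S x) := by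
    intro g
    rw [integral_image_eq_integral_abs_det_fderiv_smul volume hU.measurableSet
      (fun z hz => (hSd z hz).hasFDerivWithinAt) hinj, ← integral_const_mul]
    apply setIntegral_congr_fun hU.measurableSet
    intro z hz
    simp only [smul_eq_mul]
    rw [hdet z hz]
  have I1 : J * ∫ p, ‖φ p‖ ^ 2 = R * m ^ 2 := by
    rw [← psi_int μ hR0, ← setIntegral_eq_integral_of_forall_compl_eq_zero (s := S '' U)
      (f := fun w => ‖psi μ R w‖ ^ 2), cov]
    · congr 1
      rw [← setIntegral_eq_integral_of_forall_compl_eq_zero (s := U) (f := fun w => ‖φ w‖ ^ 2)]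
      · apply setIntegral_congr_fun hU.measurableSet
        intro z hz
        simp only
        rw [hφU z hz]
      · intro z hz
        rw [hφK z (fun h => hz (hKU h))]; simp
    · intro w hw
      rw [psi_zero hR0 (fun h => hw (hbox h))]; simp
  have I2 : J * volume.real K = 4 * R := by
    have h := cov (B.indicator 1)
    have hBm : MeasurableSet B := measurableSet_Icc.prod measurableSet_Icc
    have e1 : ∫ x in S '' U, B.indicator (1 : ℝ × ℝ → ℝ) x = 4 * R := by
      rw [setIntegral_eq_integral_of_forall_compl_eq_zero, integral_indicator_one hBm]
      · rw [hB, Measure.volume_eq_prod, measureReal_prod_prod]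
        simp [Real.volume_real_Icc_of_le (show -R ≤ R by linarith)]
        ring
      · intro w hw
        exact Set.indicator_of_notMem (fun h => hw (hbox h)) _
    have e2 : ∫ x in U, B.indicator (1 : ℝ × ℝ → ℝ) (S x) = volume.real K := by
      rw [← integral_indicator_one hKc.measurableSet,
        ← setIntegral_eq_integral_of_forall_compl_eq_zero (s := U) (f := K.indicator 1)]
      · apply setIntegral_congr_fun hU.measurableSet
        intro z hz
        by_cases h : S z ∈ B
        · have hk : z ∈ K := ⟨hz, h⟩
          simp [h, hk]
        · have hk : z ∉ K := fun hk => h hk.2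
          simp [h, hk]
      · intro z hz
        exact Set.indicator_of_notMem (fun h => hz (hKU h)) _
    rw [← e1, h, e2]
  have hKcomp : IsCompact K := (isCompact_closedBall x0 (1/4)).of_isClosed_subset hKc hKb
  set M : ℝ := (C ^ 2 * (|μ| + 3) / R) ^ 2 with hM
  have I3 : ∫ p, ‖fderiv ℝ φ p (X p) - (μ * Complex.I) * φ p‖ ^ 2 ≤ M * volume.real K := by
    rw [← setIntegral_eq_integral_of_forall_compl_eq_zero (s := K)]
    · refine (le_abs_self _).trans ?_
      rw [← Real.norm_eq_abs]
      apply norm_setIntegral_le_of_norm_le_const hKcomp.measure_lt_top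
      intro z hz
      have hzU := hKU hz
      rw [Real.norm_eq_abs, abs_of_nonneg (by positivity), (hφU' z hzU).fderiv_eq, hφU z hzU,
        fderiv_comp z ((psi_contDiff μ R).differentiable (by simp) _) (hSd z hzU).differentiableAt]
      have := psi_deriv (μ := μ) hR1 hC hb hz.2 (hKX z hz)
      rw [hM]
      gcongr
      exact this
    · intro z hz
      rw [(hφK' z hz).fderiv_eq, hφK z hz]; simp
  have I1' : ∫ p, ‖φ p‖ ^ 2 = R * m ^ 2 / J := by rw [← I1]; field_simp
  have I2' : volume.real K = 4 * R / J := by rw [← I2]; field_simp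
  refine ⟨φ, x0, hφ, fun z hz => hφK z (fun h => hz (hKb h)), ?_, ?_⟩
  · rw [I1']; positivity
  · refine I3.trans ?_
    have : M * volume.real K = D / R ^ 2 * ∫ p, ‖φ p‖ ^ 2 := by
      rw [I1', I2', hM, hD]; field_simp
    rw [this]
    apply mul_le_mul_of_nonneg_right hR2
    rw [I1']; positivity


lemma det_pair (L : ℝ × ℝ →L[ℝ] ℝ × ℝ) :
    L.det = (L (1, 0)).1 * (L (0, 1)).2 - (L (0, 1)).1 * (L (1, 0)).2 := by
  have h : L.det = LinearMap.det (L : ℝ × ℝ →ₗ[ℝ] ℝ × ℝ) := rfl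
  rw [h, ← LinearMap.det_toMatrix (Module.Basis.finTwoProd ℝ), Matrix.det_fin_two]
  simp [LinearMap.toMatrix_apply]

/-- linear functional -/
noncomputable def lin (a b : ℝ) : ℝ × ℝ →L[ℝ] ℝ :=
  a • ContinuousLinearMap.fst ℝ ℝ ℝ + b • ContinuousLinearMap.snd ℝ ℝ ℝ

lemma lin_apply (a b : ℝ) (w : ℝ × ℝ) : lin a b w = a * w.1 + b * w.2 := by simp [lin]

/-- inverse of a pair of functionals -/
noncomputable def solve (a1 a2 b1 b2 : ℝ) (w : ℝ × ℝ) : ℝ × ℝ :=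
  ((w.1 * b2 - w.2 * a2) / (a1 * b2 - a2 * b1), (a1 * w.2 - b1 * w.1) / (a1 * b2 - a2 * b1))

lemma solve_cont (a1 a2 b1 b2 : ℝ) : Continuous (solve a1 a2 b1 b2) := by
  unfold solve; fun_prop

lemma solve_left {a1 a2 b1 b2 : ℝ} (h : a1 * b2 - a2 * b1 ≠ 0) (w : ℝ × ℝ) :
    solve a1 a2 b1 b2 (lin a1 a2 w, lin b1 b2 w) = w := by
  simp only [solve, lin_apply]
  ext
  · simp only; rw [div_eq_iff h]; ring
  · simp only; rw [div_eq_iff h]; ring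

lemma solve_1 {a1 a2 b1 b2 : ℝ} (h : a1 * b2 - a2 * b1 ≠ 0) (w : ℝ × ℝ) :
    lin a1 a2 (solve a1 a2 b1 b2 w) = w.1 := by
  simp only [solve, lin_apply]
  rw [mul_div_assoc', mul_div_assoc', ← add_div, div_eq_iff h]; ring

lemma solve_2 {a1 a2 b1 b2 : ℝ} (h : a1 * b2 - a2 * b1 ≠ 0) (w : ℝ × ℝ) :
    lin b1 b2 (solve a1 a2 b1 b2 w) = w.2 := by
  simp only [solve, lin_apply]
  rw [mul_div_assoc', mul_div_assoc', ← add_div, div_eq_iff h]; ring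

lemma KK_eq {U : Set (ℝ × ℝ)} {S P : ℝ × ℝ → ℝ × ℝ} (hPU : ∀ x, P x ∈ U) (hSP : ∀ x, S (P x) = x)
    (hPS : ∀ z ∈ U, P (S z) = z) (R : ℝ) :
    KK U S R = P '' (Set.Icc (-R) R ×ˢ Set.Icc (-1 : ℝ) 1) := by
  ext z
  constructor
  · rintro ⟨h1, h2⟩
    exact ⟨S z, h2, hPS z h1⟩
  · rintro ⟨w, hw, rfl⟩
    refine ⟨hPU w, ?_⟩
    rw [hSP]; exact hw

lemma FB_of_inv {X : ℝ × ℝ → ℝ × ℝ} {R ε : ℝ} (x0 : ℝ × ℝ)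
    {U : Set (ℝ × ℝ)} {S P : ℝ × ℝ → ℝ × ℝ} {J : ℝ} (hU : IsOpen U)
    (hS : ContDiffOn ℝ (⊤ : ℕ∞) S U) (hP : Continuous P)
    (hPU : ∀ x, P x ∈ U) (hSP : ∀ x, S (P x) = x)
    (hPS : ∀ z ∈ U, P (S z) = z) (hJ : 0 < J) (hdet : ∀ z ∈ U, |(fderiv ℝ S z).det| = J)
    (hb : KK U S R ⊆ Metric.closedBall x0 (1/4))
    (hX : ∀ z ∈ KK U S R, ‖fderiv ℝ S z (X z) - (1, 0)‖ ≤ ε) : FB X R ε := by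
  refine ⟨x0, U, S, J, hU, hS, ?_, hJ, hdet, ?_, ?_, hb, hX⟩
  · intro z hz w hw h
    rw [← hPS z hz, ← hPS w hw, h]
  · intro w _
    exact ⟨P w, hPU w, hSP w⟩
  · rw [KK_eq hPU hSP hPS]
    exact ((isCompact_Icc.prod isCompact_Icc).image hP).isClosed

lemma blowup {X : ℝ × ℝ → ℝ × ℝ} {R ε : ℝ} (hε : 0 < ε) {x0 : ℝ × ℝ} {A : ℝ × ℝ →L[ℝ] ℝ × ℝ}
    (hA : HasFDerivAt X A x0) (hX0 : X x0 = 0)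
    {U : Set (ℝ × ℝ)} {S P : ℝ × ℝ → ℝ × ℝ} {J : ℝ} (hU : IsOpen U)
    (hS : ContDiffOn ℝ (⊤ : ℕ∞) S U) (hP : Continuous P)
    (hPU : ∀ x, P x ∈ U) (hSP : ∀ x, S (P x) = x)
    (hPS : ∀ z ∈ U, P (S z) = z) (hJ : 0 < J) (hdet : ∀ z ∈ U, |(fderiv ℝ S z).det| = J)
    (hX : ∀ z ∈ KK U S R, ‖fderiv ℝ S z (A z) - (1, 0)‖ ≤ ε / 2) : FB X R ε := by
  have hKc : IsCompact (KK U S R) := by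
    rw [KK_eq hPU hSP hPS]
    exact (isCompact_Icc.prod isCompact_Icc).image hP
  have hKU : KK U S R ⊆ U := fun z hz => hz.1
  have hfc : ContinuousOn (fderiv ℝ S) U := hS.continuousOn_fderiv_of_isOpen hU (by simp)
  obtain ⟨M0, hM0⟩ := hKc.exists_bound_of_continuousOn (hfc.mono hKU)
  obtain ⟨ρ0, hρ0⟩ := hKc.exists_bound_of_continuousOn (continuous_id.continuousOn)
  set M := max 1 M0 with hM
  set ρ := max 1 ρ0 with hρ
  have hM1 : 0 < M := by positivity
  have hρ1 : 0 < ρ := by positivity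
  have hη : 0 < ε / (2 * M * ρ) := by positivity
  have hlo := (hasFDerivAt_iff_isLittleO_nhds_zero.1 hA).def hη
  obtain ⟨δ, hδ, hball⟩ := Metric.eventually_nhds_iff.1 hlo
  set r := min (δ / (2 * ρ)) (1 / (4 * ρ)) with hr
  have hr0 : 0 < r := by positivity
  have hrδ : r * ρ < δ := by
    have : r ≤ δ / (2 * ρ) := min_le_left _ _
    rw [le_div_iff₀ (by positivity)] at this
    linarith
  have hr4 : r * ρ ≤ 1 / 4 := by
    have : r ≤ 1 / (4 * ρ) := min_le_right _ _
    rw [le_div_iff₀ (by positivity)] at this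
    linarith
  let T : ℝ × ℝ → ℝ × ℝ := fun z => r⁻¹ • (z - x0)
  have hTc : ContDiff ℝ (⊤ : ℕ∞) T := by simp only [T]; fun_prop
  have hTd : ∀ z, HasFDerivAt T (r⁻¹ • ContinuousLinearMap.id ℝ (ℝ × ℝ)) z := by
    intro z
    exact ((hasFDerivAt_id z).sub_const x0).const_smul r⁻¹
  have hzT : ∀ z, z = x0 + r • T z := by
    intro z; simp only [T]; rw [smul_smul, mul_inv_cancel₀ hr0.ne', one_smul]; abel
  have hTz : ∀ w, T (x0 + r • w) = w := by
    intro z; simp only [T]; rw [add_sub_cancel_left, smul_smul, inv_mul_cancel₀ hr0.ne', one_smul]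
  have hfd : ∀ z, T z ∈ U → fderiv ℝ (S ∘ T) z = r⁻¹ • fderiv ℝ S (T z) := by
    intro z hz
    have h1 : DifferentiableAt ℝ S (T z) := (hS.contDiffAt (hU.mem_nhds hz)).differentiableAt (by simp)
    rw [(h1.hasFDerivAt.comp z (hTd z)).fderiv]
    ext <;> simp
  have hKK : ∀ z ∈ KK (T ⁻¹' U) (S ∘ T) R, T z ∈ KK U S R := fun z hz => hz
  refine FB_of_inv (U := T ⁻¹' U) (S := S ∘ T) (P := fun x => x0 + r • P x) (J := (r⁻¹) ^ 2 * J) x0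
    (hU.preimage hTc.continuous) (hS.comp hTc.contDiffOn (fun z hz => hz)) (by fun_prop) ?_ ?_ ?_
    (by positivity) ?_ ?_ ?_
  · intro x; simp only [Set.mem_preimage]; rw [hTz]; exact hPU x
  · intro x; simp only [Function.comp]; rw [hTz, hSP]
  · intro z hz; simp only [Function.comp]; rw [hPS _ hz, ← hzT]
  · intro z hz
    rw [hfd z hz, ← hdet _ hz, det_pair, det_pair]
    rw [← abs_of_nonneg (show 0 ≤ (r⁻¹) ^ 2 by positivity), ← abs_mul]
    congr 1
    simp
    ring
  · intro z hz
    have h1 := hρ0 _ (hKK z hz)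
    rw [Metric.mem_closedBall, dist_eq_norm]
    have : z - x0 = r • T z := by
      conv_lhs => rw [hzT z]
      abel
    rw [this, norm_smul, Real.norm_eq_abs, abs_of_pos hr0]
    calc r * ‖T z‖ ≤ r * ρ := by gcongr; exact h1.trans (le_max_right _ _)
      _ ≤ 1/4 := hr4
  · intro z hz
    have hz' := hKK z hz
    have h1 : ‖T z‖ ≤ ρ := (hρ0 _ hz').trans (le_max_right _ _)
    have h2 : ‖fderiv ℝ S (T z)‖ ≤ M := (hM0 _ hz').trans (le_max_right _ _)
    have h3 := hX _ hz'
    set w := T z with hw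
    have h4 : ‖r • w‖ ≤ r * ρ := by
      rw [norm_smul, Real.norm_eq_abs, abs_of_pos hr0]; gcongr
    have h5 : ‖X (x0 + r • w) - X x0 - A (r • w)‖ ≤ ε / (2 * M * ρ) * ‖r • w‖ := by
      apply hball
      rw [dist_zero_right]
      linarith
    rw [hX0, sub_zero, map_smul] at h5
    rw [hfd z hz'.1, ← hw]
    have hzz : X z = r • A w + (X (x0 + r • w) - r • A w) := by
      rw [add_sub_cancel]; congr 1; exact hzT z
    rw [hzz]
    set e := X (x0 + r • w) - r • A w with he
    have e1 : (r⁻¹ • fderiv ℝ S w) (r • A w + e) - (1, 0) =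
        (fderiv ℝ S w (A w) - (1, 0)) + r⁻¹ • fderiv ℝ S w e := by
      rw [smul_apply, map_add, map_smul, smul_add, smul_smul, inv_mul_cancel₀ hr0.ne', one_smul]
      abel
    rw [e1]
    have e2 : ‖r⁻¹ • fderiv ℝ S w e‖ ≤ ε / 2 := by
      rw [norm_smul, Real.norm_eq_abs, abs_of_pos (inv_pos.2 hr0)]
      calc r⁻¹ * ‖fderiv ℝ S w e‖ ≤ r⁻¹ * (M * (ε / (2 * M * ρ) * (r * ρ))) := by
            gcongr
            refine (ContinuousLinearMap.le_opNorm _ _).trans ?_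
            gcongr
            exact h5.trans (by gcongr)
        _ = ε / 2 := by field_simp
    calc _ ≤ ε / 2 + ε / 2 := (norm_add_le _ _).trans (add_le_add h3 e2)
      _ = ε := by ring

lemma hyperbolic {X : ℝ × ℝ → ℝ × ℝ} {R ε : ℝ} (hε : 0 < ε) {x0 : ℝ × ℝ}
    {A : ℝ × ℝ →L[ℝ] ℝ × ℝ} (hA : HasFDerivAt X A x0) (hX0 : X x0 = 0) {p q d : ℝ}
    (hAe : ∀ w, A w = (-q * w.1 - d * w.2, p * w.1 + q * w.2)) (hdet : p * d - q ^ 2 < 0) :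
    FB X R ε := by
  obtain ⟨l, hl, hl0, hql⟩ : ∃ l : ℝ, l ^ 2 = q ^ 2 - p * d ∧ l ≠ 0 ∧ q + l ≠ 0 := by
    have h0 : 0 < q ^ 2 - p * d := by linarith
    have h1 := Real.sq_sqrt h0.le
    have h2 := Real.sqrt_pos.2 h0
    rcases le_or_gt 0 q with h | h
    · exact ⟨Real.sqrt (q ^ 2 - p * d), h1, h2.ne', by linarith⟩
    · exact ⟨-Real.sqrt (q ^ 2 - p * d), by rw [neg_sq, h1], by linarith, by linarith⟩
  have hD : p * d - (q + l) * (q + l) ≠ 0 := by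
    have : p * d - (q + l) * (q + l) = -2 * l * (q + l) := by linear_combination hl
    rw [this]
    exact mul_ne_zero (mul_ne_zero (by norm_num) hl0) hql
  set α := lin p (q + l) with hα
  set β := lin (q + l) d with hβ
  have hαA : ∀ w, α (A w) = l * α w := by
    intro w; rw [hAe, hα, lin_apply, lin_apply]; simp only; linear_combination w.2 * (-hl)
  have hβA : ∀ w, β (A w) = -l * β w := by
    intro w; rw [hAe, hβ, lin_apply, lin_apply]; simp only; linear_combination w.1 * hl
  let S : ℝ × ℝ → ℝ × ℝ := fun w => (Real.log (α w) / l, α w * β w)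
  let U : Set (ℝ × ℝ) := {w | 0 < α w}
  have hU : IsOpen U := isOpen_lt continuous_const α.continuous
  have hSd : ∀ w ∈ U, HasFDerivAt S
      ((l⁻¹ • ((α w)⁻¹ • α)).prod (α w • β + β w • α)) w := by
    intro w hw
    have h1 : HasFDerivAt (fun w => Real.log (α w) / l) (l⁻¹ • ((α w)⁻¹ • α)) w := by
      simp only [div_eq_inv_mul]
      exact ((α.hasFDerivAt (x := w)).log (ne_of_gt hw)).const_mul l⁻¹
    exact h1.prodMk ((α.hasFDerivAt (x := w)).mul (β.hasFDerivAt (x := w)))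
  refine blowup (U := U) (S := S) (J := |(p * d - (q + l) * (q + l)) / l|)
    (P := fun x => solve p (q + l) (q + l) d (Real.exp (l * x.1), x.2 * Real.exp (-(l * x.1))))
    hε hA hX0 hU ?_ ?_ ?_ ?_ ?_ ?_ ?_ ?_
  · apply ContDiffOn.prodMk
    · apply ContDiffOn.div_const
      exact α.contDiff.contDiffOn.log (fun w hw => ne_of_gt hw)
    · exact (α.contDiff.mul β.contDiff).contDiffOn
  · exact (solve_cont _ _ _ _).comp (by fun_prop)
  · intro x
    simp only [U, Set.mem_ofPred_eq, hα]
    rw [solve_1 hD]; positivity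
  · intro x
    simp only [S, hα, hβ]
    rw [solve_1 hD, solve_2 hD]
    ext
    · simp only [Real.log_exp]; field_simp
    · simp only; rw [mul_left_comm, ← Real.exp_add]; simp
  · intro z hz
    have hz' : 0 < α z := hz
    have : (Real.exp (l * (S z).1), (S z).2 * Real.exp (-(l * (S z).1))) = (α z, β z) := by
      simp only [S]
      rw [mul_div_cancel₀ _ hl0, Real.exp_neg, Real.exp_log hz']
      ext
      · rfl
      · simp only; field_simp
    rw [this, hα, hβ, solve_left hD]
  · positivity
  · intro z hz
    have hz' : α z ≠ 0 := ne_of_gt hz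
    rw [(hSd z hz).fderiv, det_pair]
    congr 1
    have a1 : α (1, 0) = p := by rw [hα, lin_apply]; simp
    have a2 : α (0, 1) = q + l := by rw [hα, lin_apply]; simp
    have b1 : β (1, 0) = q + l := by rw [hβ, lin_apply]; simp
    have b2 : β (0, 1) = d := by rw [hβ, lin_apply]; simp
    simp only [ContinuousLinearMap.prod_apply, add_apply, smul_apply, smul_eq_mul, a1, a2, b1, b2]
    field_simp
    ring
  · intro z hz
    have hz' : α z ≠ 0 := ne_of_gt hz.1
    rw [(hSd z hz.1).fderiv]
    have : ((l⁻¹ • ((α z)⁻¹ • α)).prod (α z • β + β z • α)) (A z) = (1, 0) := by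
      simp only [ContinuousLinearMap.prod_apply, add_apply, smul_apply, smul_eq_mul, hαA, hβA]
      ext
      · simp only; field_simp
      · simp only; ring
    rw [this, sub_self, norm_zero]; positivity

lemma nilp_aux {X : ℝ × ℝ → ℝ × ℝ} {R ε : ℝ} (hε : 0 < ε) {x0 : ℝ × ℝ}
    {A : ℝ × ℝ →L[ℝ] ℝ × ℝ} (hA : HasFDerivAt X A x0) (hX0 : X x0 = 0) {a1 a2 b1 b2 : ℝ}
    (hD : a1 * b2 - a2 * b1 ≠ 0) (h1 : ∀ w, lin a1 a2 (A w) = lin b1 b2 w)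
    (h2 : ∀ w, lin b1 b2 (A w) = 0) : FB X R ε := by
  set α := lin a1 a2 with hα
  set β := lin b1 b2 with hβ
  set δ := ε / 2 with hδ
  have hδ0 : 0 < δ := by positivity
  let S : ℝ × ℝ → ℝ × ℝ := fun w => (α w, δ⁻¹ * (β w - 1))
  have hSd : ∀ w, HasFDerivAt S (α.prod (δ⁻¹ • β)) w := by
    intro w
    exact (α.hasFDerivAt (x := w)).prodMk (((β.hasFDerivAt (x := w)).sub_const 1).const_mul δ⁻¹)
  refine blowup (U := Set.univ) (S := S) (J := |(a1 * b2 - a2 * b1) / δ|)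
    (P := fun x => solve a1 a2 b1 b2 (x.1, 1 + δ * x.2))
    hε hA hX0 isOpen_univ ?_ ?_ ?_ ?_ ?_ ?_ ?_ ?_
  · apply ContDiff.contDiffOn
    exact α.contDiff.prodMk (contDiff_const.mul (β.contDiff.sub contDiff_const))
  · exact (solve_cont _ _ _ _).comp (by fun_prop)
  · intro x; trivial
  · intro x
    simp only [S, hα, hβ]
    rw [solve_1 hD, solve_2 hD]
    ext
    · rfl
    · simp only; field_simp; ring
  · intro z hz
    have : ((S z).1, 1 + δ * (S z).2) = (α z, β z) := by
      simp only [S]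
      ext
      · rfl
      · simp only; field_simp; ring
    rw [this, hα, hβ, solve_left hD]
  · positivity
  · intro z hz
    rw [(hSd z).fderiv, det_pair]
    congr 1
    have e1 : α (1, 0) = a1 := by rw [hα, lin_apply]; simp
    have e2 : α (0, 1) = a2 := by rw [hα, lin_apply]; simp
    have e3 : β (1, 0) = b1 := by rw [hβ, lin_apply]; simp
    have e4 : β (0, 1) = b2 := by rw [hβ, lin_apply]; simp
    simp only [ContinuousLinearMap.prod_apply, smul_apply, smul_eq_mul, e1, e2, e3, e4]
    field_simp
  · intro z hz
    rw [(hSd z).fderiv]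
    have : (α.prod (δ⁻¹ • β)) (A z) - (1, 0) = (β z - 1, 0) := by
      simp [ContinuousLinearMap.prod_apply, h1, h2]
    rw [this]
    have h3 : |δ⁻¹ * (β z - 1)| ≤ 1 := abs_le.2 hz.2.2
    rw [abs_mul, abs_of_pos (inv_pos.2 hδ0), inv_mul_le_iff₀ hδ0, mul_one] at h3
    have h4 : ‖((β z - 1, 0) : ℝ × ℝ)‖ = |β z - 1| := by simp [Prod.norm_def]
    rw [h4]; exact h3

lemma nilpotent {X : ℝ × ℝ → ℝ × ℝ} {R ε : ℝ} (hε : 0 < ε) {x0 : ℝ × ℝ}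
    {A : ℝ × ℝ →L[ℝ] ℝ × ℝ} (hA : HasFDerivAt X A x0) (hX0 : X x0 = 0) {p q d : ℝ}
    (hAe : ∀ w, A w = (-q * w.1 - d * w.2, p * w.1 + q * w.2)) (hdet : p * d - q ^ 2 = 0)
    (hne : ¬ (p = 0 ∧ q = 0 ∧ d = 0)) :
    FB X R ε := by
  by_cases hd : d = 0
  · subst hd
    have hq : q = 0 := by
      have : q ^ 2 = 0 := by linarith
      simpa using this
    subst hq
    have hp : p ≠ 0 := fun h => hne ⟨h, rfl, rfl⟩
    refine nilp_aux (a1 := 0) (a2 := 1) (b1 := p) (b2 := 0) hε hA hX0 (by simpa using hp) ?_ ?_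
    · intro w; rw [hAe, lin_apply, lin_apply]; simp
    · intro w; rw [hAe, lin_apply]; simp
  · refine nilp_aux (a1 := 1) (a2 := 0) (b1 := -q) (b2 := -d) hε hA hX0 (by simpa using hd) ?_ ?_
    · intro w; rw [hAe, lin_apply, lin_apply]; simp only; ring
    · intro w; rw [hAe, lin_apply]; simp only; linear_combination -w.1 * hdet

lemma zerocase {X : ℝ × ℝ → ℝ × ℝ} {R ε : ℝ} (hR : 1 ≤ R) (hε : 0 < ε) {x0 : ℝ × ℝ}
    (hA : HasStrictFDerivAt X (0 : ℝ × ℝ →L[ℝ] ℝ × ℝ) x0) (hX0 : X x0 = 0)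
    (hcl : x0 ∈ closure {z | X z ≠ 0}) : FB X R ε := by
  set η := min (1 / (8 * R)) (ε / (4 * R)) with hη
  have hη0 : 0 < η := by positivity
  have hη1 : η * (8 * R) ≤ 1 := by
    rw [← le_div_iff₀ (by positivity)]; exact min_le_left _ _
  have hη2 : η * (4 * R) ≤ ε := by
    rw [← le_div_iff₀ (by positivity)]; exact min_le_right _ _
  have hlo := hA.isLittleO.def hη0
  obtain ⟨r0, hr0, hball⟩ := Metric.eventually_nhds_iff.1 hlo
  set r := min (r0 / 2) (1/8) with hr
  have hr1 : 0 < r := by positivity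
  have hr2 : 2 * r ≤ r0 := by
    have : r ≤ r0 / 2 := min_le_left _ _
    linarith
  have hr3 : r ≤ 1/8 := min_le_right _ _
  have hlip : ∀ z z', dist z x0 < 2 * r → dist z' x0 < 2 * r → ‖X z - X z'‖ ≤ η * ‖z - z'‖ := by
    intro z z' h1 h2
    have := hball (y := (z, z')) (by rw [Prod.dist_eq]; exact max_lt (by simpa using h1.trans_le hr2) (by simpa using h2.trans_le hr2))
    simpa using this
  obtain ⟨x, hx, hxd⟩ := Metric.mem_closure_iff.1 hcl r hr1
  rw [dist_comm] at hxd
  have hvn : ‖X x‖ ≤ η * r := by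
    have := hlip x x0 (by linarith) (by rw [dist_self]; linarith)
    rw [hX0, sub_zero, ← dist_eq_norm] at this
    exact this.trans (by gcongr)
  set v := X x with hv
  have hv0 : 0 < ‖v‖ := norm_pos_iff.2 hx
  set N := v.1 ^ 2 + v.2 ^ 2 with hN
  have hv1 : |v.1| ≤ ‖v‖ := norm_fst_le v
  have hv2 : |v.2| ≤ ‖v‖ := norm_snd_le v
  have hNn : ‖v‖ ^ 2 ≤ N := by
    rcases max_cases ‖v.1‖ ‖v.2‖ with h | h
    · rw [Prod.norm_def, h.1, Real.norm_eq_abs, sq_abs, hN]; nlinarith [sq_nonneg v.2]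
    · rw [Prod.norm_def, h.1, Real.norm_eq_abs, sq_abs, hN]; nlinarith [sq_nonneg v.1]
  have hN0 : 0 < N := lt_of_lt_of_le (by positivity) hNn
  set α := lin (v.1 / N) (v.2 / N) with hα
  set β := lin (-v.2 / N) (v.1 / N) with hβ
  have hDe : v.1 / N * (v.1 / N) - v.2 / N * (-v.2 / N) = 1 / N := by
    rw [hN]; rw [hN] at hN0; field_simp; ring
  have hD : v.1 / N * (v.1 / N) - v.2 / N * (-v.2 / N) ≠ 0 := by rw [hDe]; positivity
  let S : ℝ × ℝ → ℝ × ℝ := fun z => (α (z - x), β (z - x))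
  have hSd : ∀ w, HasFDerivAt S (α.prod β) w := by
    intro w
    have h0 : HasFDerivAt (fun z => z - x) (ContinuousLinearMap.id ℝ (ℝ × ℝ)) w :=
      (hasFDerivAt_id w).sub_const x
    exact ((α.prod β).hasFDerivAt (x := w - x)).comp w h0
  have hPS : ∀ z, z = x + solve (v.1 / N) (v.2 / N) (-v.2 / N) (v.1 / N) (S z) := by
    intro z
    simp only [S, hα, hβ]
    rw [solve_left hD]; abel
  have hdist : ∀ z ∈ KK Set.univ S R, ‖z - x‖ ≤ 2 * R * ‖v‖ := by
    intro z hz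
    have h1 : |α (z - x)| ≤ R := abs_le.2 hz.2.1
    have h2 : |β (z - x)| ≤ R := (abs_le.2 hz.2.2).trans hR
    have e1 : (z - x).1 = α (z - x) * v.1 - β (z - x) * v.2 := by
      rw [hα, hβ, lin_apply, lin_apply, hN]; rw [hN] at hN0; field_simp; ring
    have e2 : (z - x).2 = α (z - x) * v.2 + β (z - x) * v.1 := by
      rw [hα, hβ, lin_apply, lin_apply, hN]; rw [hN] at hN0; field_simp; ring
    rw [Prod.norm_def, max_le_iff, Real.norm_eq_abs, Real.norm_eq_abs, e1, e2]
    constructor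
    · refine (abs_sub _ _).trans ?_
      rw [abs_mul, abs_mul]
      calc _ ≤ R * ‖v‖ + R * ‖v‖ := by gcongr
        _ = _ := by ring
    · refine (abs_add_le _ _).trans ?_
      rw [abs_mul, abs_mul]
      calc _ ≤ R * ‖v‖ + R * ‖v‖ := by gcongr
        _ = _ := by ring
  have hdist2 : ∀ z ∈ KK Set.univ S R, dist z x0 < 2 * r := by
    intro z hz
    have h1 := hdist z hz
    have h2 : 2 * R * ‖v‖ ≤ r / 4 := by
      calc 2 * R * ‖v‖ ≤ 2 * R * (η * r) := by gcongr
        _ = (η * (8 * R)) * r / 4 := by ring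
        _ ≤ 1 * r / 4 := by gcongr
        _ = r / 4 := by ring
    rw [← dist_eq_norm] at h1
    linarith [dist_triangle z x x0]
  refine FB_of_inv (U := Set.univ) (S := S) (J := 1 / N) x0
    (P := fun w => x + solve (v.1 / N) (v.2 / N) (-v.2 / N) (v.1 / N) w) isOpen_univ ?_ ?_ ?_ ?_ ?_
    (by positivity) ?_ ?_ ?_
  · apply ContDiff.contDiffOn
    exact (α.contDiff.comp (contDiff_id.sub contDiff_const)).prodMk
      (β.contDiff.comp (contDiff_id.sub contDiff_const))
  · exact continuous_const.add (solve_cont _ _ _ _)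
  · intro w; trivial
  · intro w
    simp only [S, hα, hβ, add_sub_cancel_left]
    rw [solve_1 hD, solve_2 hD]
  · intro z _; exact (hPS z).symm
  · intro z _
    rw [(hSd z).fderiv, det_pair]
    have e1 : α (1, 0) = v.1 / N := by rw [hα, lin_apply]; simp
    have e2 : α (0, 1) = v.2 / N := by rw [hα, lin_apply]; simp
    have e3 : β (1, 0) = -v.2 / N := by rw [hβ, lin_apply]; simp
    have e4 : β (0, 1) = v.1 / N := by rw [hβ, lin_apply]; simp
    simp only [ContinuousLinearMap.prod_apply, e1, e2, e3, e4]
    rw [hDe, abs_of_pos (by positivity)]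
  · intro z hz
    rw [Metric.mem_closedBall]
    linarith [hdist2 z hz]
  · intro z hz
    rw [(hSd z).fderiv]
    have h1 : ‖X z - v‖ ≤ η * ‖z - x‖ := hlip z x (hdist2 z hz) (by linarith)
    have h2 : ‖X z - v‖ ≤ η * (2 * R * ‖v‖) := h1.trans (by gcongr; exact hdist z hz)
    have e0 : (α.prod β) v = (1, 0) := by
      rw [ContinuousLinearMap.prod_apply, hα, hβ, lin_apply, lin_apply, hN]
      rw [hN] at hN0
      ext
      · simp only; field_simp
      · simp only; field_simp; ring
    rw [← e0, ← map_sub]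
    set y := X z - v with hy
    have hy1 : |y.1| ≤ ‖y‖ := norm_fst_le y
    have hy2 : |y.2| ≤ ‖y‖ := norm_snd_le y
    have fin : 2 * (‖v‖ * ‖y‖) / N ≤ ε := by
      rw [div_le_iff₀ hN0]
      calc 2 * (‖v‖ * ‖y‖) ≤ 2 * (‖v‖ * (η * (2 * R * ‖v‖))) := by gcongr
        _ = (η * (4 * R)) * ‖v‖ ^ 2 := by ring
        _ ≤ ε * N := by gcongr
    rw [ContinuousLinearMap.prod_apply, Prod.norm_def, max_le_iff]
    simp only [Real.norm_eq_abs]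
    constructor
    · have : α y = (v.1 * y.1 + v.2 * y.2) / N := by rw [hα, lin_apply]; ring
      rw [this, abs_div, abs_of_pos hN0]
      refine le_trans ?_ fin
      gcongr
      refine (abs_add_le _ _).trans ?_
      rw [abs_mul, abs_mul]
      calc _ ≤ ‖v‖ * ‖y‖ + ‖v‖ * ‖y‖ := by gcongr
        _ = _ := by ring
    · have : β y = (v.1 * y.2 - v.2 * y.1) / N := by rw [hβ, lin_apply]; ring
      rw [this, abs_div, abs_of_pos hN0]
      refine le_trans ?_ fin
      gcongr
      refine (abs_sub _ _).trans ?_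
      rw [abs_mul, abs_mul]
      calc _ ≤ ‖v‖ * ‖y‖ + ‖v‖ * ‖y‖ := by gcongr
        _ = _ := by ring


lemma int_sq {h : ℝ × ℝ → ℝ} (hc : Continuous h) :
    ∫ p in Set.Icc (0:ℝ) 1 ×ˢ Set.Icc (0:ℝ) 1, h p = ∫ x in (0:ℝ)..1, ∫ y in (0:ℝ)..1, h (x, y) := by
  rw [Measure.volume_eq_prod, setIntegral_prod]
  · rw [intervalIntegral.integral_of_le (by linarith), integral_Icc_eq_integral_Ioc]
    congr 1
    funext x
    rw [intervalIntegral.integral_of_le (by linarith), integral_Icc_eq_integral_Ioc]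
  · exact (hc.continuousOn).integrableOn_compact (isCompact_Icc.prod isCompact_Icc)

lemma symm_pd {f : ℝ × ℝ → ℝ} (hf : ContDiff ℝ (⊤ : ℕ∞) f) (a b z : ℝ × ℝ) :
    fderiv ℝ (fun z => fderiv ℝ f z a) z b = fderiv ℝ (fun z => fderiv ℝ f z b) z a := by
  have h : ContDiff ℝ (⊤ : ℕ∞) (fderiv ℝ f) := hf.fderiv_right (by simp)
  have hd : DifferentiableAt ℝ (fderiv ℝ f) z := h.differentiable (by simp) z
  have hs : IsSymmSndFDerivAt ℝ f z := hf.contDiffAt.isSymmSndFDerivAt (by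
    rw [minSmoothness_of_isRCLikeNormedField]; exact WithTop.coe_le_coe.2 le_top)
  rw [fderiv_clm_apply hd (differentiableAt_const _), fderiv_clm_apply hd (differentiableAt_const _)]
  simpa using hs b a

lemma pd_contDiff {f : ℝ × ℝ → ℝ} (hf : ContDiff ℝ (⊤ : ℕ∞) f) (a : ℝ × ℝ) :
    ContDiff ℝ (⊤ : ℕ∞) (fun z => fderiv ℝ f z a) := by
  have h : ContDiff ℝ (⊤ : ℕ∞) (fderiv ℝ f) := hf.fderiv_right (by simp)
  fun_prop

lemma degree_zero {u v : ℝ × ℝ → ℝ} (hu : ContDiff ℝ (⊤ : ℕ∞) u) (hv : ContDiff ℝ (⊤ : ℕ∞) v)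
    (hup : ∀ (m n : ℤ) (x y : ℝ), u (x + m, y + n) = u (x, y))
    (hvp : ∀ (m n : ℤ) (x y : ℝ), v (x + m, y + n) = v (x, y))
    {G g k k' : ℝ → ℝ} (hG : ∀ t, HasDerivAt G (g t) t) (hg : Continuous g)
    (hk : ∀ t, HasDerivAt k (k' t) t) (hk' : Continuous k') :
    ∫ z in Set.Icc (0:ℝ) 1 ×ˢ Set.Icc (0:ℝ) 1, g (u z) * k (v z) *
      (fderiv ℝ u z (1, 0) * fderiv ℝ v z (0, 1) - fderiv ℝ u z (0, 1) * fderiv ℝ v z (1, 0)) = 0 := by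
  have hGc : Continuous G := continuous_iff_continuousAt.2 fun t => (hG t).continuousAt
  have hkc : Continuous k := continuous_iff_continuousAt.2 fun t => (hk t).continuousAt
  have hud : ∀ z, HasFDerivAt u (fderiv ℝ u z) z := fun z =>
    (hu.differentiable (by simp) z).hasFDerivAt
  have hvd : ∀ z, HasFDerivAt v (fderiv ℝ v z) z := fun z =>
    (hv.differentiable (by simp) z).hasFDerivAt
  have hx := pd_contDiff hv (1, 0)
  have hy := pd_contDiff hv (0, 1)
  have hux := pd_contDiff hu (1, 0)
  have huy := pd_contDiff hu (0, 1)
  set vx : ℝ × ℝ → ℝ := fun z => fderiv ℝ v z (1, 0) with hvx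
  set vy : ℝ × ℝ → ℝ := fun z => fderiv ℝ v z (0, 1) with hvy
  have hxd : ∀ z, HasFDerivAt vx (fderiv ℝ vx z) z := fun z =>
    (hx.differentiable (by simp) z).hasFDerivAt
  have hyd : ∀ z, HasFDerivAt vy (fderiv ℝ vy z) z := fun z =>
    (hy.differentiable (by simp) z).hasFDerivAt
  have hcd : ∀ z, HasFDerivAt (fun z => G (u z) * k (v z))
      (G (u z) • (k' (v z) • fderiv ℝ v z) + k (v z) • (g (u z) • fderiv ℝ u z)) z := fun z =>
    ((hG (u z)).comp_hasFDerivAt z (hud z)).mul ((hk (v z)).comp_hasFDerivAt z (hvd z))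
  have hfd := fun z => (hcd z).mul (hyd z)
  have hgd := fun z => ((hcd z).mul (hxd z)).neg
  have huc := hu.continuous
  have hvc := hv.continuous
  have hxc := hx.continuous
  have hyc := hy.continuous
  have huxc := hux.continuous
  have huyc := huy.continuous
  have hsym : ∀ z, fderiv ℝ vy z (1, 0) = fderiv ℝ vx z (0, 1) := fun z => symm_pd hv _ _ z
  set W : ℝ × ℝ → ℝ := fun z => g (u z) * k (v z) *
      (fderiv ℝ u z (1, 0) * vy z - fderiv ℝ u z (0, 1) * vx z) with hW
  have hWc : Continuous W := by
    simp only [hW]; fun_prop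
  have hint := integral2_divergence_prod_of_hasFDerivAt
    (fun z => G (u z) * k (v z) * vy z) (fun z => -(G (u z) * k (v z) * vx z))
    (fun z => (G (u z) * k (v z)) • fderiv ℝ vy z +
      vy z • (G (u z) • (k' (v z) • fderiv ℝ v z) + k (v z) • (g (u z) • fderiv ℝ u z)))
    (fun z => -((G (u z) * k (v z)) • fderiv ℝ vx z +
      vx z • (G (u z) • (k' (v z) • fderiv ℝ v z) + k (v z) • (g (u z) • fderiv ℝ u z))))
    0 0 1 1
    (Continuous.continuousOn (by fun_prop)) (Continuous.continuousOn (by fun_prop))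
    (fun z _ => hfd z) (fun z _ => hgd z)
  have heq : ∀ z, ((G (u z) * k (v z)) • fderiv ℝ vy z +
      vy z • (G (u z) • (k' (v z) • fderiv ℝ v z) + k (v z) • (g (u z) • fderiv ℝ u z))) (1, 0) +
      (-((G (u z) * k (v z)) • fderiv ℝ vx z +
      vx z • (G (u z) • (k' (v z) • fderiv ℝ v z) + k (v z) • (g (u z) • fderiv ℝ u z)))) (0, 1)
      = W z := by
    intro z
    simp only [add_apply, neg_apply, smul_apply, smul_eq_mul, hsym, hW]
    simp only [hvx, hvy]
    ring
  simp only [heq] at hint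
  have hvyp : ∀ (m n : ℤ) (x y : ℝ), vy (x + m, y + n) = vy (x, y) := by
    intro m n x y; simp only [hvy]; rw [fderiv_per hvp]
  have hvxp : ∀ (m n : ℤ) (x y : ℝ), vx (x + m, y + n) = vx (x, y) := by
    intro m n x y; simp only [hvx]; rw [fderiv_per hvp]
  have p1 : ∀ {f : ℝ × ℝ → ℝ}, (∀ (m n : ℤ) (x y : ℝ), f (x + m, y + n) = f (x, y)) →
      ∀ y, f (1, y) = f (0, y) := by
    intro f hf y; simpa using hf 1 0 0 y
  have p2 : ∀ {f : ℝ × ℝ → ℝ}, (∀ (m n : ℤ) (x y : ℝ), f (x + m, y + n) = f (x, y)) →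
      ∀ x, f (x, 1) = f (x, 0) := by
    intro f hf x; simpa using hf 0 1 x 0
  rw [int_sq hWc, hint (hWc.continuousOn.integrableOn_compact (isCompact_uIcc.prod isCompact_uIcc))]
  simp only [p1 hup, p1 hvp, p1 hvyp, p2 hup, p2 hvp, p2 hvxp]
  ring

lemma exists_bad (Ω : ℝ × ℝ → ℝ) (hΩ : ContDiff ℝ (⊤ : ℕ∞) Ω)
    (hΩper : ∀ (m n : ℤ) (x y : ℝ), Ω (x + m, y + n) = Ω (x, y)) :
    ∃ z, fderiv ℝ Ω z (1, 0) = 0 ∧ fderiv ℝ Ω z (0, 1) = 0 ∧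
      fderiv ℝ (fun z => fderiv ℝ Ω z (1, 0)) z (1, 0) * fderiv ℝ (fun z => fderiv ℝ Ω z (0, 1)) z (0, 1)
      - fderiv ℝ (fun z => fderiv ℝ Ω z (1, 0)) z (0, 1) * fderiv ℝ (fun z => fderiv ℝ Ω z (0, 1)) z (1, 0)
      ≤ 0 := by
  by_contra hcon
  push Not at hcon
  have hu := pd_contDiff hΩ (1, 0)
  have hv := pd_contDiff hΩ (0, 1)
  have hup : ∀ (m n : ℤ) (x y : ℝ), fderiv ℝ Ω (x + m, y + n) (1, 0) = fderiv ℝ Ω (x, y) (1, 0) := by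
    intro m n x y; rw [fderiv_per hΩper]
  have hvp : ∀ (m n : ℤ) (x y : ℝ), fderiv ℝ Ω (x + m, y + n) (0, 1) = fderiv ℝ Ω (x, y) (0, 1) := by
    intro m n x y; rw [fderiv_per hΩper]
  set Q : Set (ℝ × ℝ) := Set.Icc (0:ℝ) 1 ×ˢ Set.Icc (0:ℝ) 1 with hQ
  have hQc : IsCompact Q := isCompact_Icc.prod isCompact_Icc
  -- a critical point in the square
  obtain ⟨z0, hz0, hmax⟩ := hQc.exists_isMaxOn ⟨(0, 0), by simp [hQ]⟩ hΩ.continuous.continuousOn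
  have hglob : ∀ z, Ω z ≤ Ω z0 := by
    rintro ⟨x, y⟩
    have h1 : Ω (x, y) = Ω (Int.fract x, Int.fract y) := by
      have := hΩper ⌊x⌋ ⌊y⌋ (Int.fract x) (Int.fract y)
      rwa [Int.fract_add_floor, Int.fract_add_floor] at this
    rw [h1]
    exact hmax ⟨⟨Int.fract_nonneg x, (Int.fract_lt_one x).le⟩, ⟨Int.fract_nonneg y, (Int.fract_lt_one y).le⟩⟩
  have hcrit : fderiv ℝ Ω z0 = 0 :=
    IsLocalMax.fderiv_eq_zero (Filter.Eventually.of_forall hglob)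
  set u : ℝ × ℝ → ℝ := fun z => fderiv ℝ Ω z (1, 0) with hudef
  set v : ℝ × ℝ → ℝ := fun z => fderiv ℝ Ω z (0, 1) with hvdef
  set Dt : ℝ × ℝ → ℝ := fun z => fderiv ℝ u z (1, 0) * fderiv ℝ v z (0, 1)
      - fderiv ℝ u z (0, 1) * fderiv ℝ v z (1, 0) with hDt
  have hcon' : ∀ z, u z = 0 → v z = 0 → 0 < Dt z := fun z h1 h2 => hcon z h1 h2
  have huc := hu.continuous
  have hvc := hv.continuous
  have hDc : Continuous Dt := by
    have h1 := (pd_contDiff hu (1, 0)).continuous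
    have h2 := (pd_contDiff hu (0, 1)).continuous
    have h3 := (pd_contDiff hv (1, 0)).continuous
    have h4 := (pd_contDiff hv (0, 1)).continuous
    simp only [hDt]; fun_prop
  obtain ⟨δ, hδ, hδD⟩ : ∃ δ > 0, ∀ z ∈ Q, |u z| < δ → |v z| < δ → 0 < Dt z := by
    have hCc : IsCompact (Q ∩ {z | Dt z ≤ 0}) := hQc.inter_right (isClosed_le hDc continuous_const)
    rcases (Q ∩ {z | Dt z ≤ 0}).eq_empty_or_nonempty with he | hne
    · refine ⟨1, one_pos, fun z hz _ _ => ?_⟩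
      by_contra h
      have : z ∈ Q ∩ {z | Dt z ≤ 0} := ⟨hz, not_lt.1 h⟩
      rw [he] at this; exact this
    · obtain ⟨z1, hz1, hmin⟩ := hCc.exists_isMinOn hne
        (f := fun z => max |u z| |v z|) (by fun_prop)
      refine ⟨max |u z1| |v z1|, ?_, fun z hz h1 h2 => ?_⟩
      · by_contra h
        have h' := max_le_iff.1 (not_lt.1 h)
        have h1 : u z1 = 0 := by simpa using h'.1
        have h2 : v z1 = 0 := by simpa using h'.2
        exact absurd hz1.2 (not_le.2 (hcon' z1 h1 h2))
      · by_contra h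
        have : max |u z1| |v z1| ≤ max |u z| |v z| := hmin ⟨hz, not_lt.1 h⟩
        exact absurd (max_lt h1 h2) (not_lt.2 this)
  let g : ℝ → ℝ := fun t => expNegInvGlue (δ ^ 2 - t ^ 2)
  have hgC : ContDiff ℝ (⊤ : ℕ∞) g := expNegInvGlue.contDiff.comp (by fun_prop)
  have hgc : Continuous g := hgC.continuous
  have hg0 : ∀ t, 0 ≤ g t := fun t => expNegInvGlue.nonneg _
  have hgz : ∀ t, ¬ |t| < δ → g t = 0 := by
    intro t ht
    apply expNegInvGlue.zero_of_nonpos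
    rw [not_lt] at ht
    rw [← sq_abs t]; nlinarith
  have hgp : 0 < g 0 := expNegInvGlue.pos_of_pos (by simp; positivity)
  have hint := degree_zero hu hv hup hvp (G := fun t => ∫ s in (0:ℝ)..t, g s) (g := g) (k := g)
    (k' := deriv g)
    (fun t => intervalIntegral.integral_hasDerivAt_right (hgc.intervalIntegrable _ _)
      (hgc.stronglyMeasurableAtFilter _ _) hgc.continuousAt)
    hgc (fun t => (hgC.differentiable (by simp) t).hasDerivAt) (hgC.continuous_deriv (by simp))
  have hWc : Continuous (fun z => g (u z) * g (v z) * Dt z) := by fun_prop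
  have hW0 : ∀ z ∈ Q, 0 ≤ g (u z) * g (v z) * Dt z := by
    intro z hz
    by_cases h1 : |u z| < δ
    · by_cases h2 : |v z| < δ
      · exact mul_nonneg (mul_nonneg (hg0 _) (hg0 _)) (hδD z hz h1 h2).le
      · rw [hgz _ h2]; simp
    · rw [hgz _ h1]; simp
  have hQm : MeasurableSet Q := measurableSet_Icc.prod measurableSet_Icc
  have hae := (setIntegral_eq_zero_iff_of_nonneg_ae (f := fun z => g (u z) * g (v z) * Dt z)
    ((ae_restrict_iff' hQm).2 (Filter.Eventually.of_forall hW0))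
    (hWc.continuousOn.integrableOn_compact hQc)).1 hint
  have heq := Measure.eqOn_of_ae_eq hae hWc.continuousOn continuousOn_const (by
    rw [hQ, interior_prod_eq, closure_prod_eq, interior_Icc, closure_Ioo (by norm_num)])
  have h0 := heq hz0
  have hu0 : u z0 = 0 := by simp [hudef, hcrit]
  have hv0 : v z0 = 0 := by simp [hvdef, hcrit]
  simp only [hu0, hv0] at h0
  have := hcon' z0 hu0 hv0
  have hpos : 0 < g 0 * g 0 * Dt z0 := by positivity
  rw [h0] at hpos
  simp at hpos

lemma XX_zero {Ω : ℝ × ℝ → ℝ} {z : ℝ × ℝ} :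
    XX Ω z = 0 ↔ fderiv ℝ Ω z (1, 0) = 0 ∧ fderiv ℝ Ω z (0, 1) = 0 := by
  unfold XX
  rw [Prod.ext_iff]
  simp [and_comm]

lemma boxes (Ω : ℝ × ℝ → ℝ) (hΩ : ContDiff ℝ (⊤ : ℕ∞) Ω)
    (hΩper : ∀ (m n : ℤ) (x y : ℝ), Ω (x + m, y + n) = Ω (x, y))
    (hΩnc : ¬ ∃ c : ℝ, ∀ p : ℝ × ℝ, Ω p = c) {R ε : ℝ} (hR : 1 ≤ R) (hε : 0 < ε) :
    FB (XX Ω) R ε := by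
  have hX := XX_contDiff hΩ
  obtain ⟨z, hz1, hz2, hz3⟩ := exists_bad Ω hΩ hΩper
  have hu := pd_contDiff hΩ (1, 0)
  have hv := pd_contDiff hΩ (0, 1)
  have hsym := symm_pd hΩ (1, 0) (0, 1) z
  have hA : HasFDerivAt (XX Ω) ((-(fderiv ℝ (fun z => fderiv ℝ Ω z (0, 1)) z)).prod
      (fderiv ℝ (fun z => fderiv ℝ Ω z (1, 0)) z)) z :=
    ((hv.differentiable (by simp) z).hasFDerivAt.neg).prodMk
      (hu.differentiable (by simp) z).hasFDerivAt
  set Du := fderiv ℝ (fun z => fderiv ℝ Ω z (1, 0)) z with hDu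
  set Dv := fderiv ℝ (fun z => fderiv ℝ Ω z (0, 1)) z with hDv
  have hX0 : XX Ω z = 0 := XX_zero.2 ⟨hz1, hz2⟩
  have hAe : ∀ w : ℝ × ℝ, ((-Dv).prod Du) w =
      (-(Du (0, 1)) * w.1 - Dv (0, 1) * w.2, Du (1, 0) * w.1 + Du (0, 1) * w.2) := by
    rintro ⟨a, b⟩
    rw [ContinuousLinearMap.prod_apply, neg_apply, fderiv_pair Dv, fderiv_pair Du, hsym]
    simp only [smul_eq_mul]
    ext
    · simp only; ring
    · simp only; ring
  rw [← hsym, ← sq] at hz3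
  rcases hz3.lt_or_eq with h | h
  · exact hyperbolic hε hA hX0 hAe h
  by_cases hne : Du (1, 0) = 0 ∧ Du (0, 1) = 0 ∧ Dv (0, 1) = 0
  swap
  · exact nilpotent hε hA hX0 hAe h hne
  have hfd0 : fderiv ℝ (XX Ω) z = 0 := by
    rw [hA.fderiv]
    ext w <;> rw [ContinuousLinearMap.comp_apply, hAe] <;> simp [hne]
  -- pass to a frontier point
  have hstrict : ∀ w, fderiv ℝ (XX Ω) w = 0 →
      HasStrictFDerivAt (XX Ω) (0 : ℝ × ℝ →L[ℝ] ℝ × ℝ) w := by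
    intro w hw
    rw [← hw]
    exact hX.contDiffAt.hasStrictFDerivAt (by simp)
  by_cases hcl : z ∈ closure {w | XX Ω w ≠ 0}
  · exact zerocase hR hε (hstrict z hfd0) hX0 hcl
  set V : Set (ℝ × ℝ) := (closure {w | XX Ω w ≠ 0})ᶜ with hV
  have hVo : IsOpen V := isClosed_closure.isOpen_compl
  have hV0 : ∀ w ∈ V, XX Ω w = 0 := by
    intro w hw
    by_contra h
    exact hw (subset_closure h)
  have hVd : ∀ w ∈ V, fderiv ℝ (XX Ω) w = 0 := by
    intro w hw
    have : XX Ω =ᶠ[nhds w] fun _ => 0 := by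
      filter_upwards [hVo.mem_nhds hw] with y hy using hV0 y hy
    rw [this.fderiv_eq]; simp
  have hVne : V ≠ Set.univ := by
    intro h
    apply hΩnc
    refine ⟨Ω 0, fun p => ?_⟩
    apply is_const_of_fderiv_eq_zero (𝕜 := ℝ) (hΩ.differentiable (by simp))
    intro w
    have := XX_zero.1 (hV0 w (h ▸ Set.mem_univ w))
    ext <;> simp [this]
  have hfr : (frontier V).Nonempty := by
    rw [Set.nonempty_iff_ne_empty]
    intro h
    have hclo : IsClopen V := isClopen_iff_frontier_eq_empty.2 h
    rcases isClopen_iff.1 hclo with h1 | h1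
    · have : z ∈ V := hcl
      rw [h1] at this; exact this
    · exact hVne h1
  obtain ⟨w, hw⟩ := hfr
  rw [hVo.frontier_eq] at hw
  have hwcl : w ∈ closure {w | XX Ω w ≠ 0} := by
    by_contra h; exact hw.2 h
  have hw0 : XX Ω w = 0 := by
    have hc : IsClosed {w | XX Ω w = 0} := isClosed_eq hX.continuous continuous_const
    exact closure_minimal (fun y hy => hV0 y hy) hc hw.1
  have hwd : fderiv ℝ (XX Ω) w = 0 := by
    have hc : IsClosed {w | fderiv ℝ (XX Ω) w = 0} :=
      isClosed_eq (hX.continuous_fderiv (by simp)) continuous_const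
    exact closure_minimal (fun y hy => hVd y hy) hc hw.1
  exact zerocase hR hε (hstrict w hwd) hw0 hwcl

/-- For a smooth, `ℤ²`-periodic, nonconstant vorticity `Ω`, every purely imaginary
number `iμ` is an approximate eigenvalue of the operator `L φ = {Ω, φ}` on `L²(T²)`:
there are smooth periodic functions `φₙ` of unit `L²` norm over the fundamental domain
with `‖{Ω, φₙ} − iμ φₙ‖_{L²} → 0`. This expresses the inclusion `iℝ ⊆ σ_{L²(T²)}(L)`. -/
theorem laxOperator_2d_spectrum_contains_imaginary_axis
    (Ω : ℝ × ℝ → ℝ) (hΩ : ContDiff ℝ (⊤ : ℕ∞) Ω)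
    (hΩper : ∀ (m n : ℤ) (x y : ℝ), Ω (x + m, y + n) = Ω (x, y))
    (hΩnc : ¬ ∃ c : ℝ, ∀ p : ℝ × ℝ, Ω p = c) :
    ∀ μ : ℝ, ∃ φ : ℕ → ℝ × ℝ → ℂ,
      (∀ n, ContDiff ℝ (⊤ : ℕ∞) (φ n)) ∧
      (∀ n, ∀ (m k : ℤ) (x y : ℝ), φ n (x + m, y + k) = φ n (x, y)) ∧
      (∀ n, ∫ p in Set.Icc (0 : ℝ) 1 ×ˢ Set.Icc (0 : ℝ) 1, ‖φ n p‖ ^ 2 = 1) ∧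
      Tendsto
        (fun n => ∫ p in Set.Icc (0 : ℝ) 1 ×ˢ Set.Icc (0 : ℝ) 1,
          ‖bracket (fun r => (Ω r : ℂ)) (φ n) p - (μ * Complex.I) * φ n p‖ ^ 2)
        atTop (nhds 0) := by
  intro μ
  exact reduction Ω hΩ hΩper μ
    (flowbox (fun R hR => boxes Ω hΩ hΩper hΩnc hR
      (by have h0 : (0:ℝ) < R := by linarith
          positivity)) μ)
end

section
/- Let u, Ω : ℝ × ℝ³ → ℝ³ be smooth with ∇·u(t,·) = 0 and Ω(t,·) = ∇×u(t,·) for every t, and assume Ω solves the 3D Euler equation in vorticity form ∂ₜΩ + (u·∇)Ω − (Ω·∇)u = 0. Let λ ∈ ℂ and let φ : ℝ × ℝ³ → ℂ³ be a smooth solution of the second Lax equation ∂ₜφ + (u·∇)φ − (φ·∇)u = 0. Then ψ := (Ω·∇)φ − (φ·∇)Ω − λφ also solves ∂ₜψ + (u·∇)ψ − (ψ·∇)u = 0 identically on ℝ × ℝ³. (This is the verification of Childress's Lax pair of the 3D Euler equation.) -/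
/-- Partial derivative `∂ⱼ` in the `j`-th spatial variable on `ℝ³ = Fin 3 → ℝ`. -/
noncomputable def pd3 {E : Type*} [NormedAddCommGroup E] [NormedSpace ℝ E]
    (j : Fin 3) (g : (Fin 3 → ℝ) → E) (p : Fin 3 → ℝ) : E :=
  deriv (fun s => g (Function.update p j s)) (p j)

/-- The advective derivative `(a·∇)b = Σⱼ aⱼ ∂ⱼ b` of a vector field, componentwise. -/
noncomputable def adv {𝕜 : Type*} [NormedCommRing 𝕜] [NormedSpace ℝ 𝕜]
    (a b : (Fin 3 → ℝ) → Fin 3 → 𝕜) (p : Fin 3 → ℝ) : Fin 3 → 𝕜 :=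
  fun i => ∑ j, a p j * pd3 j (fun q => b q i) p

/-- The advective derivative `(a·∇)g = Σⱼ aⱼ ∂ⱼ g` of a scalar function. -/
noncomputable def advS {𝕜 : Type*} [NormedCommRing 𝕜] [NormedSpace ℝ 𝕜]
    (a : (Fin 3 → ℝ) → Fin 3 → 𝕜) (g : (Fin 3 → ℝ) → 𝕜) (p : Fin 3 → ℝ) : 𝕜 :=
  ∑ j, a p j * pd3 j g p

/-- The divergence `∇·u = Σⱼ ∂ⱼ uⱼ`. -/
noncomputable def div3 (u : (Fin 3 → ℝ) → Fin 3 → ℝ) (p : Fin 3 → ℝ) : ℝ :=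
  ∑ j, pd3 j (fun q => u q j) p

/-- The curl `∇×u`. -/
noncomputable def curl3 (u : (Fin 3 → ℝ) → Fin 3 → ℝ) (p : Fin 3 → ℝ) : Fin 3 → ℝ :=
  ![pd3 1 (fun q => u q 2) p - pd3 2 (fun q => u q 1) p,
    pd3 2 (fun q => u q 0) p - pd3 0 (fun q => u q 2) p,
    pd3 0 (fun q => u q 1) p - pd3 1 (fun q => u q 0) p]

theorem lax_algebra {A : Type*} [CommRing A] [Algebra ℝ A] (T : Derivation ℝ A A)
    (D : Fin 3 → Derivation ℝ A A)
    (hT : ∀ j a, T (D j a) = D j (T a)) (hD : ∀ j k a, D j (D k a) = D k (D j a))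
    (lam : A) (hl0 : T lam = 0) (hl : ∀ j, D j lam = 0)
    (U W F P : Fin 3 → A)
    (hW : ∀ i, T (W i) + ∑ j, U j * D j (W i) - ∑ j, W j * D j (U i) = 0)
    (hF : ∀ i, T (F i) + ∑ j, U j * D j (F i) - ∑ j, F j * D j (U i) = 0)
    (hP : ∀ i, P i = ∑ j, W j * D j (F i) - ∑ j, F j * D j (W i) - lam * F i) (i : Fin 3) :
    T (P i) + ∑ j, U j * D j (P i) - ∑ j, P j * D j (U i) = 0 := by
  have hW' : ∀ i, T (W i) = ∑ j, W j * D j (U i) - ∑ j, U j * D j (W i) := fun i => by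
    linear_combination hW i
  have hF' : ∀ i, T (F i) = ∑ j, F j * D j (U i) - ∑ j, U j * D j (F i) := fun i => by
    linear_combination hF i
  simp only [hP, Fin.sum_univ_three, map_add, map_sub, Derivation.leibniz, smul_eq_mul, hT, hW',
    hF', hl0, hl, hD 1 0, hD 2 0, hD 2 1]
  ring

/-- Smooth complex functions on space-time. -/
def SmoothAlg : Subalgebra ℝ (ℝ × (Fin 3 → ℝ) → ℂ) where
  carrier := {f | ContDiff ℝ (⊤ : ℕ∞) f}
  mul_mem' := fun ha hb => Set.mem_ofPred.2 (ContDiff.mul (Set.mem_ofPred.1 ha) (Set.mem_ofPred.1 hb))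
  add_mem' := fun ha hb => Set.mem_ofPred.2 (ContDiff.add (Set.mem_ofPred.1 ha) (Set.mem_ofPred.1 hb))
  algebraMap_mem' := fun r => Set.mem_ofPred.2 (contDiff_const (c := (algebraMap ℝ ℂ r)))

theorem mem_SmoothAlg {f : ℝ × (Fin 3 → ℝ) → ℂ} : f ∈ SmoothAlg ↔ ContDiff ℝ (⊤ : ℕ∞) f :=
  Set.mem_ofPred

theorem smooth_diff_s7 (f : SmoothAlg) : Differentiable ℝ f.1 :=
  ContDiff.differentiable (mem_SmoothAlg.1 f.2) (by simp)

/-- Directional derivative. -/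
noncomputable def dirD (v : ℝ × (Fin 3 → ℝ)) : Derivation ℝ SmoothAlg SmoothAlg :=
  Derivation.mk'
    { toFun := fun f => ⟨fun q => fderiv ℝ f.1 q v,
        mem_SmoothAlg.2 ((ContDiff.fderiv_right (m := (⊤ : ℕ∞)) (mem_SmoothAlg.1 f.2) (by simp)).clm_apply contDiff_const)⟩
      map_add' := fun f g => by
        apply Subtype.ext; funext q
        have := fderiv_add (smooth_diff_s7 f q) (smooth_diff_s7 g q)
        change fderiv ℝ (f.1 + g.1) q v = fderiv ℝ f.1 q v + fderiv ℝ g.1 q v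
        rw [this]; rfl
      map_smul' := fun r f => by
        apply Subtype.ext; funext q
        have := fderiv_const_smul (smooth_diff_s7 f q) r
        change fderiv ℝ (r • f.1) q v = r • fderiv ℝ f.1 q v
        rw [this]; rfl }
    (fun f g => by
      apply Subtype.ext; funext q
      have := fderiv_mul (smooth_diff_s7 f q) (smooth_diff_s7 g q)
      change fderiv ℝ (f.1 * g.1) q v = f.1 q * fderiv ℝ g.1 q v + g.1 q * fderiv ℝ f.1 q v
      rw [this]; rfl)

theorem dirD_apply (v : ℝ × (Fin 3 → ℝ)) (f : SmoothAlg) (q) :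
    (dirD v f).1 q = fderiv ℝ f.1 q v := rfl

theorem dirD_comm (v w : ℝ × (Fin 3 → ℝ)) (f : SmoothAlg) :
    dirD v (dirD w f) = dirD w (dirD v f) := by
  apply Subtype.ext; funext q
  have hd : DifferentiableAt ℝ (fderiv ℝ f.1) q :=
    (ContDiff.fderiv_right (m := (⊤ : ℕ∞)) (mem_SmoothAlg.1 f.2) (by simp)).differentiable (by simp) q
  have key : ∀ a b, (dirD a (dirD b f)).1 q = fderiv ℝ (fderiv ℝ f.1) q a b := by
    intro a b
    change fderiv ℝ (fun q => fderiv ℝ f.1 q b) q a = _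
    rw [fderiv_clm_apply hd (differentiableAt_const _)]
    simp
  rw [key, key]
  have hs : IsSymmSndFDerivAt ℝ f.1 q :=
    (ContDiff.contDiffAt (mem_SmoothAlg.1 f.2)).isSymmSndFDerivAt (by
      rw [minSmoothness_of_isRCLikeNormedField]; exact WithTop.coe_le_coe.2 (le_top : (2 : ℕ∞) ≤ ⊤))
  exact hs v w

theorem dirD_time (f : SmoothAlg) (t : ℝ) (p : Fin 3 → ℝ) :
    deriv (fun s => f.1 (s, p)) t = (dirD (1, 0) f).1 (t, p) := by
  have h : HasDerivAt (fun s : ℝ => (s, p)) ((1 : ℝ), (0 : Fin 3 → ℝ)) t :=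
    (hasDerivAt_id t).prodMk (hasDerivAt_const t p)
  exact ((smooth_diff_s7 f (t, p)).hasFDerivAt.comp_hasDerivAt t h).deriv

theorem dirD_space (f : SmoothAlg) (j : Fin 3) (t : ℝ) (p : Fin 3 → ℝ) :
    pd3 j (fun q => f.1 (t, q)) p = (dirD (0, Pi.single j 1) f).1 (t, p) := by
  have h : HasDerivAt (fun s : ℝ => (t, Function.update p j s))
      ((0 : ℝ), (Pi.single j 1 : Fin 3 → ℝ)) (p j) :=
    (hasDerivAt_const _ t).prodMk (hasDerivAt_update p j (p j))
  have hf : HasFDerivAt f.1 (fderiv ℝ f.1 (t, p)) (t, Function.update p j (p j)) := by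
    rw [Function.update_eq_self]; exact (smooth_diff_s7 f (t, p)).hasFDerivAt
  exact (hf.comp_hasDerivAt (p j) h).deriv

theorem pdt_comp (G : Fin 3 → SmoothAlg) (f : ℝ × (Fin 3 → ℝ) → Fin 3 → ℂ)
    (hG : ∀ q i, f q i = (G i).1 q) (t : ℝ) (p : Fin 3 → ℝ) (i : Fin 3) :
    pdt f (t, p) i = (dirD (1, 0) (G i)).1 (t, p) := by
  rw [← dirD_time]
  unfold pdt
  have hd : ∀ i, DifferentiableAt ℝ (fun s => f (s, p) i) t := by
    intro i
    simp only [hG]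
    exact (smooth_diff_s7 (G i) (t, p)).comp t
      (differentiableAt_id.prodMk (differentiableAt_const p))
  have := deriv_pi hd
  simp only [this, hG]

theorem adv_comp (a b : Fin 3 → SmoothAlg) (f g : ℝ × (Fin 3 → ℝ) → Fin 3 → ℂ)
    (ha : ∀ q i, f q i = (a i).1 q) (hb : ∀ q i, g q i = (b i).1 q)
    (t : ℝ) (p : Fin 3 → ℝ) (i : Fin 3) :
    adv (fun q j => f (t, q) j) (fun q j => g (t, q) j) p i
      = (∑ j, a j * dirD (0, Pi.single j 1) (b i)).1 (t, p) := by
  simp only [adv, ha, hb, dirD_space, Fin.sum_univ_three]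
  rfl

/-- Verification of Childress's Lax pair of the 3D Euler equation: if `φ` solves the
second Lax equation, then `ψ := (Ω·∇)φ − (φ·∇)Ω − λφ` solves the same linear evolution
equation `∂ₜψ + (u·∇)ψ − (ψ·∇)u = 0`. -/
theorem childress_laxPair_3d_verification
    (u Ω : ℝ × (Fin 3 → ℝ) → Fin 3 → ℝ)
    (hu : ContDiff ℝ (⊤ : ℕ∞) u) (hΩ : ContDiff ℝ (⊤ : ℕ∞) Ω)
    (hdiv : ∀ t p, div3 (fun q => u (t, q)) p = 0)
    (hcurl : ∀ t p, Ω (t, p) = curl3 (fun q => u (t, q)) p)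
    (heuler : ∀ t p,
      pdt Ω (t, p) + adv (fun q => u (t, q)) (fun q => Ω (t, q)) p
        - adv (fun q => Ω (t, q)) (fun q => u (t, q)) p = 0)
    (lam : ℂ) (φ : ℝ × (Fin 3 → ℝ) → Fin 3 → ℂ) (hφ : ContDiff ℝ (⊤ : ℕ∞) φ)
    (hlax : ∀ t p,
      pdt φ (t, p) + adv (fun q j => (u (t, q) j : ℂ)) (fun q => φ (t, q)) p
        - adv (fun q => φ (t, q)) (fun q j => (u (t, q) j : ℂ)) p = 0)
    (ψ : ℝ × (Fin 3 → ℝ) → Fin 3 → ℂ)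
    (hψ : ψ = fun q =>
      adv (fun r j => (Ω (q.1, r) j : ℂ)) (fun r => φ (q.1, r)) q.2
        - adv (fun r => φ (q.1, r)) (fun r j => (Ω (q.1, r) j : ℂ)) q.2
        - lam • φ q) :
    ∀ t p,
      pdt ψ (t, p) + adv (fun q j => (u (t, q) j : ℂ)) (fun q => ψ (t, q)) p
        - adv (fun q => ψ (t, q)) (fun q j => (u (t, q) j : ℂ)) p = 0 := by
  let U : Fin 3 → SmoothAlg := fun i => ⟨fun q => (u q i : ℂ),
    mem_SmoothAlg.2 (Complex.ofRealCLM.contDiff.comp (contDiff_pi.1 hu i))⟩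
  let W : Fin 3 → SmoothAlg := fun i => ⟨fun q => (Ω q i : ℂ),
    mem_SmoothAlg.2 (Complex.ofRealCLM.contDiff.comp (contDiff_pi.1 hΩ i))⟩
  let F : Fin 3 → SmoothAlg := fun i => ⟨fun q => φ q i, mem_SmoothAlg.2 (contDiff_pi.1 hφ i)⟩
  let L : SmoothAlg := ⟨fun _ => lam, mem_SmoothAlg.2 contDiff_const⟩
  let D : Fin 3 → Derivation ℝ SmoothAlg SmoothAlg := fun j => dirD (0, Pi.single j 1)
  let P : Fin 3 → SmoothAlg := fun i => ∑ j, W j * D j (F i) - ∑ j, F j * D j (W i) - L * F i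
  have hL : ∀ v, dirD v L = 0 := by
    intro v
    apply Subtype.ext; funext q
    change fderiv ℝ (fun _ => lam) q v = 0
    simp
  have hU : ∀ q i, (fun q j => (u q j : ℂ)) q i = (U i).1 q := fun _ _ => rfl
  have hWc : ∀ q i, (fun q j => (Ω q j : ℂ)) q i = (W i).1 q := fun _ _ => rfl
  have hFc : ∀ q i, φ q i = (F i).1 q := fun _ _ => rfl
  have hPc : ∀ q i, ψ q i = (P i).1 q := by
    rintro ⟨t, p⟩ i
    have h1 := adv_comp W F _ _ hWc hFc t p i
    have h2 := adv_comp F W _ _ hFc hWc t p i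
    rw [hψ]
    exact congrArg₂ (· - ·) (congrArg₂ (· - ·) h1 h2) rfl
  have hF : ∀ i, dirD (1, 0) (F i) + ∑ j, U j * D j (F i) - ∑ j, F j * D j (U i) = 0 := by
    intro i
    apply Subtype.ext; funext ⟨t, p⟩
    have h0 := pdt_comp F _ hFc t p i
    have h1 := adv_comp U F _ _ hU hFc t p i
    have h2 := adv_comp F U _ _ hFc hU t p i
    have h := congrFun (hlax t p) i
    exact (congrArg₂ (· - ·) (congrArg₂ (· + ·) h0 h1) h2).symm.trans h
  have hW : ∀ i, dirD (1, 0) (W i) + ∑ j, U j * D j (W i) - ∑ j, W j * D j (U i) = 0 := by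
    intro i
    apply Subtype.ext; funext ⟨t, p⟩
    have h0 := pdt_comp W _ hWc t p i
    have h1 := adv_comp U W _ _ hU hWc t p i
    have h2 := adv_comp W U _ _ hWc hU t p i
    refine (congrArg₂ (· - ·) (congrArg₂ (· + ·) h0 h1) h2).symm.trans ?_
    have h := congrArg (fun x : ℝ => (x : ℂ)) (congrFun (heuler t p) i)
    have e0 : pdt (fun q j => (Ω q j : ℂ)) (t, p) i = ((pdt Ω (t, p) i : ℝ) : ℂ) := by
      rw [h0, ← dirD_time]
      have hd : ∀ i, DifferentiableAt ℝ (fun s => Ω (s, p) i) t := fun i =>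
        DifferentiableAt.comp (g := fun q => Ω q i) (f := fun s => (s, p)) t
          ((contDiff_pi.1 hΩ i).differentiable (by simp) (t, p))
          (differentiableAt_id.prodMk (differentiableAt_const p))
      have h3 : pdt Ω (t, p) i = deriv (fun s => Ω (s, p) i) t := by
        unfold pdt
        simp only [deriv_pi hd]
      rw [h3]
      exact (hd i).hasDerivAt.ofReal_comp.deriv
    have e1 : ∀ (v : ℝ × (Fin 3 → ℝ) → Fin 3 → ℝ), ContDiff ℝ (⊤ : ℕ∞) v → ∀ j,
        pd3 j (fun q => ((v (t, q) i : ℝ) : ℂ)) p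
          = ((pd3 j (fun q => v (t, q) i) p : ℝ) : ℂ) := by
      intro v hv j
      have hd : DifferentiableAt ℝ (fun s => v (t, Function.update p j s) i) (p j) :=
        ((contDiff_pi.1 hv i).differentiable (by simp) _).comp (p j)
          ((differentiableAt_const t).prodMk (hasDerivAt_update p j (p j)).differentiableAt)
      exact hd.hasDerivAt.ofReal_comp.deriv
    rw [e0]
    simp only [adv, e1 u hu, e1 Ω hΩ]
    simp only [adv, Pi.add_apply, Pi.sub_apply, Pi.zero_apply] at h
    push_cast at h
    exact h
  intro t p
  funext i
  have key := lax_algebra (dirD (1, 0)) D (fun j a => dirD_comm _ _ a)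
    (fun j k a => dirD_comm _ _ a) L (hL _) (fun j => hL _) U W F P hW hF (fun i => rfl) i
  have h0 := pdt_comp P _ hPc t p i
  have h1 := adv_comp U P _ _ hU hPc t p i
  have h2 := adv_comp P U _ _ hPc hU t p i
  refine (congrArg₂ (· - ·) (congrArg₂ (· + ·) h0 h1) h2).trans ?_
  exact congrFun (congrArg Subtype.val key) (t, p)
end

section
/- Let u, Ω : ℝ × ℝ³ → ℝ³ be smooth with ∇·u(t,·) = 0 and Ω(t,·) = ∇×u(t,·) for every t, and assume Ω solves the 3D Euler equation ∂ₜΩ + (u·∇)Ω − (Ω·∇)u = 0. Assume uniqueness for the linear evolution: any smooth ψ : ℝ × ℝ³ → ℂ³ with ∂ₜψ + (u·∇)ψ − (ψ·∇)u = 0 and ψ(0,·) ≡ 0 vanishes identically. Let λ ∈ ℂ and let φ : ℝ × ℝ³ → ℂ³ solve ∂ₜφ + (u·∇)φ − (φ·∇)u = 0 with initial eigenfunction condition (Ω(0,·)·∇)φ(0,·) − (φ(0,·)·∇)Ω(0,·) = λ φ(0,·). Then for every t, (Ω(t,·)·∇)φ(t,·) − (φ(t,·)·∇)Ω(t,·)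 = λ φ(t,·); i.e., the eigenvalue λ of Childress's operator L is preserved under the 3D Euler flow. -/
noncomputable def DD (v : ℝ × (Fin 3 → ℝ)) (f : ℝ × (Fin 3 → ℝ) → ℂ) (q : ℝ × (Fin 3 → ℝ)) : ℂ :=
  fderiv ℝ f q v

def ee (j : Fin 3) : ℝ × (Fin 3 → ℝ) := (0, Pi.single j 1)

theorem DD_smooth (v : ℝ × (Fin 3 → ℝ)) {f : ℝ × (Fin 3 → ℝ) → ℂ}
    (hf : ContDiff ℝ (⊤ : ℕ∞) f) : ContDiff ℝ (⊤ : ℕ∞) (DD v f) := by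
  unfold DD
  exact (hf.fderiv_right (m := (⊤ : ℕ∞)) (by simp)).clm_apply contDiff_const

theorem sm_diff {f : ℝ × (Fin 3 → ℝ) → ℂ}
    (hf : ContDiff ℝ (⊤ : ℕ∞) f) : Differentiable ℝ f := hf.differentiable (by simp)

theorem DD_comm (v w : ℝ × (Fin 3 → ℝ)) {f : ℝ × (Fin 3 → ℝ) → ℂ}
    (hf : ContDiff ℝ (⊤ : ℕ∞) f) (q : ℝ × (Fin 3 → ℝ)) : DD v (DD w f) q = DD w (DD v f) q := by
  have hs : IsSymmSndFDerivAt ℝ f q := by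
    apply hf.contDiffAt.isSymmSndFDerivAt
    rw [minSmoothness_of_isRCLikeNormedField]
    exact WithTop.coe_le_coe.2 (le_top : (2 : ℕ∞) ≤ ⊤)
  have hd : DifferentiableAt ℝ (fderiv ℝ f) q :=
    ((hf.fderiv_right (m := (⊤ : ℕ∞)) (by simp)).differentiable (by simp)) q
  have h : ∀ v w, DD v (DD w f) q = fderiv ℝ (fderiv ℝ f) q v w := by
    intro v w
    unfold DD
    rw [fderiv_clm_apply hd (differentiableAt_const w)]
    simp
  rw [h, h]
  exact hs v w

theorem DD_comb (v : ℝ × (Fin 3 → ℝ)) (A B C E : Fin 3 → ℝ × (Fin 3 → ℝ) → ℂ)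
    (hA : ∀ j, ContDiff ℝ (⊤ : ℕ∞) (A j)) (hB : ∀ j, ContDiff ℝ (⊤ : ℕ∞) (B j))
    (hC : ∀ j, ContDiff ℝ (⊤ : ℕ∞) (C j)) (hE : ∀ j, ContDiff ℝ (⊤ : ℕ∞) (E j))
    (q : ℝ × (Fin 3 → ℝ)) :
    DD v (fun q => ∑ j, (A j q * B j q - C j q * E j q)) q =
      ∑ j, (DD v (A j) q * B j q + A j q * DD v (B j) q
        - (DD v (C j) q * E j q + C j q * DD v (E j) q)) := by
  have h : HasFDerivAt (fun q => ∑ j, (A j q * B j q - C j q * E j q))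
      (∑ j, ((A j q • fderiv ℝ (B j) q + B j q • fderiv ℝ (A j) q)
        - (C j q • fderiv ℝ (E j) q + E j q • fderiv ℝ (C j) q))) q := by
    apply HasFDerivAt.fun_sum
    intro j _
    exact ((sm_diff (hA j) q).hasFDerivAt.mul (sm_diff (hB j) q).hasFDerivAt).sub
      ((sm_diff (hC j) q).hasFDerivAt.mul (sm_diff (hE j) q).hasFDerivAt)
  unfold DD
  rw [h.fderiv]
  simp only [sum_apply, sub_apply,
    add_apply, smul_apply, smul_eq_mul]
  exact Finset.sum_congr rfl (fun j _ => by ring)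

theorem DD_eig (v : ℝ × (Fin 3 → ℝ)) (lam : ℂ) {f g : ℝ × (Fin 3 → ℝ) → ℂ}
    (hf : ContDiff ℝ (⊤ : ℕ∞) f) (hg : ContDiff ℝ (⊤ : ℕ∞) g) (q : ℝ × (Fin 3 → ℝ)) :
    DD v (fun q => f q - lam * g q) q = DD v f q - lam * DD v g q := by
  have h : HasFDerivAt (fun q => f q - lam * g q)
      (fderiv ℝ f q - lam • fderiv ℝ g q) q :=
    (sm_diff hf q).hasFDerivAt.sub ((sm_diff hg q).hasFDerivAt.const_mul lam)
  unfold DD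
  rw [h.fderiv]
  simp

theorem pd3_DD (j : Fin 3) {f : ℝ × (Fin 3 → ℝ) → ℂ}
    (hf : ContDiff ℝ (⊤ : ℕ∞) f) (t : ℝ) (p : Fin 3 → ℝ) :
    pd3 j (fun q => f (t, q)) p = DD (ee j) f (t, p) := by
  unfold pd3 DD ee
  have h1 : HasDerivAt (fun s : ℝ => (t, Function.update p j s)) (0, Pi.single j 1) (p j) :=
    (hasDerivAt_const _ _).prodMk (hasDerivAt_update p j (p j))
  have h2 : HasFDerivAt f (fderiv ℝ f (t, p)) (t, Function.update p j (p j)) := by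
    rw [Function.update_eq_self]
    exact (sm_diff hf _).hasFDerivAt
  exact (h2.comp_hasDerivAt (p j) h1).deriv

theorem pdt_DD {f : ℝ × (Fin 3 → ℝ) → Fin 3 → ℂ}
    (hf : ContDiff ℝ (⊤ : ℕ∞) f) (t : ℝ) (p : Fin 3 → ℝ) (i : Fin 3) :
    pdt f (t, p) i = DD (1, 0) (fun q => f q i) (t, p) := by
  have hi : ContDiff ℝ (⊤ : ℕ∞) (fun q => f q i) := contDiff_pi.1 hf i
  have h1 : HasDerivAt (fun s : ℝ => (s, p)) ((1 : ℝ), (0 : Fin 3 → ℝ)) t :=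
    (hasDerivAt_id _).prodMk (hasDerivAt_const _ _)
  have h2 := (hf.differentiable (by simp) (t, p)).hasFDerivAt.comp_hasDerivAt t h1
  have h3 := (sm_diff hi (t, p)).hasFDerivAt.comp_hasDerivAt t h1
  have h4 := hasDerivAt_pi.1 h2 i
  unfold pdt DD
  rw [show deriv (fun s => f (s, (t, p).2)) (t, p).1 = _ from h2.deriv]
  exact h4.unique h3

theorem lax_iff {u φ : ℝ × (Fin 3 → ℝ) → Fin 3 → ℂ}
    (hu : ContDiff ℝ (⊤ : ℕ∞) u) (hφ : ContDiff ℝ (⊤ : ℕ∞) φ) :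
    (∀ t p, pdt φ (t, p) + adv (fun q => u (t, q)) (fun q => φ (t, q)) p
        - adv (fun q => φ (t, q)) (fun q => u (t, q)) p = 0) ↔
    ∀ i, DD (1, 0) (fun q => φ q i) = fun q => ∑ j, (φ q j * DD (ee j) (fun q => u q i) q
        - u q j * DD (ee j) (fun q => φ q i) q) := by
  have hui := contDiff_pi.1 hu
  have hφi := contDiff_pi.1 hφ
  constructor
  · intro h i
    funext ⟨t, p⟩
    have := congrFun (h t p) i
    simp only [Pi.sub_apply, Pi.add_apply, adv, Pi.zero_apply, pdt_DD hφ,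
      fun j => pd3_DD j (hui i), fun j => pd3_DD j (hφi i)] at this
    rw [Finset.sum_sub_distrib]
    linear_combination this
  · intro h t p
    funext i
    have := congrFun (h i) (t, p)
    simp only [Pi.sub_apply, Pi.add_apply, adv, Pi.zero_apply, pdt_DD hφ,
      fun j => pd3_DD j (hui i), fun j => pd3_DD j (hφi i)]
    rw [Finset.sum_sub_distrib] at this
    linear_combination this

theorem ofReal_smooth {u : ℝ × (Fin 3 → ℝ) → Fin 3 → ℝ} (hu : ContDiff ℝ (⊤ : ℕ∞) u) :
    ContDiff ℝ (⊤ : ℕ∞) (fun q j => (u q j : ℂ)) :=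
  contDiff_pi.2 fun j => Complex.ofRealCLM.contDiff.comp (contDiff_pi.1 hu j)

theorem pd3_ofReal (j : Fin 3) {g : (Fin 3 → ℝ) → ℝ} (hg : Differentiable ℝ g) (p : Fin 3 → ℝ) :
    pd3 j (fun q => (g q : ℂ)) p = ((pd3 j g p : ℝ) : ℂ) := by
  unfold pd3
  have h1 : DifferentiableAt ℝ (fun s : ℝ => g (Function.update p j s)) (p j) :=
    (hg _).comp (p j) (hasDerivAt_update p j (p j)).differentiableAt
  exact h1.hasDerivAt.ofReal_comp.deriv

theorem euler_complex {u Ω : ℝ × (Fin 3 → ℝ) → Fin 3 → ℝ}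
    (hu : ContDiff ℝ (⊤ : ℕ∞) u) (hΩ : ContDiff ℝ (⊤ : ℕ∞) Ω)
    (h : ∀ t p,
      pdt Ω (t, p) + adv (fun q => u (t, q)) (fun q => Ω (t, q)) p
        - adv (fun q => Ω (t, q)) (fun q => u (t, q)) p = 0) (t : ℝ) (p : Fin 3 → ℝ) :
      pdt (fun q j => (Ω q j : ℂ)) (t, p)
        + adv (fun q j => (u (t, q) j : ℂ)) (fun q j => (Ω (t, q) j : ℂ)) p
        - adv (fun q j => (Ω (t, q) j : ℂ)) (fun q j => (u (t, q) j : ℂ)) p = 0 := by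
  funext i
  have hd : ∀ {f : ℝ × (Fin 3 → ℝ) → Fin 3 → ℝ}, ContDiff ℝ (⊤ : ℕ∞) f →
      Differentiable ℝ (fun q => f (t, q) i) := fun {f} hf =>
    ((contDiff_pi.1 hf i).differentiable (by simp)).comp
      ((differentiable_const t).prodMk differentiable_id)
  have hp : pdt (fun q j => (Ω q j : ℂ)) (t, p) i = ((pdt Ω (t, p) i : ℝ) : ℂ) := by
    have h0 : HasDerivAt (fun s => Ω (s, p)) (pdt Ω (t, p)) t :=
      ((hΩ.differentiable (by simp)).comp
        (differentiable_id.prodMk (differentiable_const p)) t).hasDerivAt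
    have h1 : HasDerivAt (fun s j => (Ω (s, p) j : ℂ)) (fun j => (pdt Ω (t, p) j : ℂ)) t :=
      hasDerivAt_pi.2 fun j => (hasDerivAt_pi.1 h0 j).ofReal_comp
    exact congrFun h1.deriv i
  have := congrArg (fun x : ℝ => (x : ℂ)) (congrFun (h t p) i)
  simp only [Pi.sub_apply, Pi.add_apply, adv, Pi.zero_apply] at this ⊢
  rw [hp]
  simp only [fun j => pd3_ofReal j (hd hu), fun j => pd3_ofReal j (hd hΩ)]
  push_cast at this
  exact this

/-- Isospectrality of Childress's Lax pair: if `φ` solves the second Lax equation and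
its initial datum is an eigenfunction of `L = (Ω(0,·)·∇)· − (··∇)Ω(0,·)` with eigenvalue
`λ`, then `φ(t,·)` is an eigenfunction of `L` at time `t` with the same eigenvalue `λ`. -/
theorem childress_laxPair_3d_isospectral
    (u Ω : ℝ × (Fin 3 → ℝ) → Fin 3 → ℝ)
    (hu : ContDiff ℝ (⊤ : ℕ∞) u) (hΩ : ContDiff ℝ (⊤ : ℕ∞) Ω)
    (hdiv : ∀ t p, div3 (fun q => u (t, q)) p = 0)
    (hcurl : ∀ t p, Ω (t, p) = curl3 (fun q => u (t, q)) p)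
    (heuler : ∀ t p,
      pdt Ω (t, p) + adv (fun q => u (t, q)) (fun q => Ω (t, q)) p
        - adv (fun q => Ω (t, q)) (fun q => u (t, q)) p = 0)
    (huniq : ∀ ψ : ℝ × (Fin 3 → ℝ) → Fin 3 → ℂ, ContDiff ℝ (⊤ : ℕ∞) ψ →
      (∀ t p,
        pdt ψ (t, p) + adv (fun q j => (u (t, q) j : ℂ)) (fun q => ψ (t, q)) p
          - adv (fun q => ψ (t, q)) (fun q j => (u (t, q) j : ℂ)) p = 0) →
      (∀ p, ψ (0, p) = 0) → ∀ q, ψ q = 0)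
    (lam : ℂ) (φ : ℝ × (Fin 3 → ℝ) → Fin 3 → ℂ) (hφ : ContDiff ℝ (⊤ : ℕ∞) φ)
    (hlax : ∀ t p,
      pdt φ (t, p) + adv (fun q j => (u (t, q) j : ℂ)) (fun q => φ (t, q)) p
        - adv (fun q => φ (t, q)) (fun q j => (u (t, q) j : ℂ)) p = 0)
    (hinit : ∀ p,
      adv (fun r j => (Ω (0, r) j : ℂ)) (fun r => φ (0, r)) p
        - adv (fun r => φ (0, r)) (fun r j => (Ω (0, r) j : ℂ)) p = lam • φ (0, p)) :
    ∀ t p,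
      adv (fun r j => (Ω (t, r) j : ℂ)) (fun r => φ (t, r)) p
        - adv (fun r => φ (t, r)) (fun r j => (Ω (t, r) j : ℂ)) p = lam • φ (t, p) := by
  have hU := ofReal_smooth hu
  have hW := ofReal_smooth hΩ
  have hW0 := (lax_iff hU hW).1 (euler_complex hu hΩ heuler)
  have hP0 := (lax_iff hU hφ).1 hlax
  have hUi := contDiff_pi.1 hU
  have hWi := contDiff_pi.1 hW
  have hPi := contDiff_pi.1 hφ
  generalize hUd : (fun q j => (u q j : ℂ)) = U at *
  generalize hWd : (fun q j => (Ω q j : ℂ)) = W at *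
  have hUe : ∀ q j, (u q j : ℂ) = U q j := fun q j => by rw [← hUd]
  have hWe : ∀ q j, (Ω q j : ℂ) = W q j := fun q j => by rw [← hWd]
  simp only [hUe, hWe] at *
  let G : Fin 3 → ℝ × (Fin 3 → ℝ) → ℂ := fun i q =>
    ∑ j, (W q j * DD (ee j) (fun q => φ q i) q - φ q j * DD (ee j) (fun q => W q i) q)
  have hG : ∀ i, ContDiff ℝ (⊤ : ℕ∞) (G i) := fun i =>
    ContDiff.sum fun j _ => ((hWi j).mul (DD_smooth _ (hPi i))).sub
      ((hPi j).mul (DD_smooth _ (hWi i)))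
  let ψ : ℝ × (Fin 3 → ℝ) → Fin 3 → ℂ := fun q i => G i q - lam * φ q i
  have hψ : ContDiff ℝ (⊤ : ℕ∞) ψ :=
    contDiff_pi.2 fun i => (hG i).sub (contDiff_const.mul (hPi i))
  have hL : ∀ t p i, (adv (fun r j => W (t, r) j) (fun r => φ (t, r)) p
        - adv (fun r => φ (t, r)) (fun r j => W (t, r) j) p) i = G i (t, p) := by
    intro t p i
    simp only [Pi.sub_apply, adv, G, Finset.sum_sub_distrib,
      fun j => pd3_DD j (hWi i), fun j => pd3_DD j (hPi i)]
  have key := huniq ψ hψ ((lax_iff hU hψ).2 ?_) ?_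
  · intro t p
    funext i
    rw [hL]
    have := congrFun (key (t, p)) i
    simp only [ψ, Pi.zero_apply] at this
    simp only [Pi.smul_apply, smul_eq_mul]
    linear_combination this
  · intro i
    funext q
    have e1 : ∀ v, DD v (fun q => ψ q i) q = DD v (G i) q - lam * DD v (fun q => φ q i) q :=
      fun v => DD_eig v lam (hG i) (hPi i) q
    have e2 : ∀ v, DD v (G i) q = _ := fun v => DD_comb v (fun j q => W q j)
      (fun j => DD (ee j) (fun q => φ q i)) (fun j q => φ q j)
      (fun j => DD (ee j) (fun q => W q i)) hWi (fun j => DD_smooth _ (hPi i)) hPi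
      (fun j => DD_smooth _ (hWi i)) q
    have e3 : ∀ k, DD (ee k) (DD (1, 0) (fun q => φ q i)) q = _ := fun k =>
      (congrArg (fun f => DD (ee k) f q) (hP0 i)).trans <| DD_comb (ee k) (fun j q => φ q j)
        (fun j => DD (ee j) (fun q => U q i)) (fun j q => U q j)
        (fun j => DD (ee j) (fun q => φ q i)) hPi (fun j => DD_smooth _ (hUi i)) hUi
        (fun j => DD_smooth _ (hPi i)) q
    have e4 : ∀ k, DD (ee k) (DD (1, 0) (fun q => W q i)) q = _ := fun k =>
      (congrArg (fun f => DD (ee k) f q) (hW0 i)).trans <| DD_comb (ee k) (fun j q => W q j)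
        (fun j => DD (ee j) (fun q => U q i)) (fun j q => U q j)
        (fun j => DD (ee j) (fun q => W q i)) hWi (fun j => DD_smooth _ (hUi i)) hUi
        (fun j => DD_smooth _ (hWi i)) q
    have c : ∀ {f : ℝ × (Fin 3 → ℝ) → ℂ}, ContDiff ℝ (⊤ : ℕ∞) f → ∀ k,
        DD (1, 0) (DD (ee k) f) q = DD (ee k) (DD (1, 0) f) q := fun hf k => DD_comm _ _ hf q
    have p0 : ∀ i, DD (1, 0) (fun q => φ q i) q = _ := fun i => congrFun (hP0 i) q
    have w0 : ∀ i, DD (1, 0) (fun q => W q i) q = _ := fun i => congrFun (hW0 i) q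
    simp only [e1, e2, c (hPi i), c (hWi i), e3, e4, p0, w0]
    simp only [ψ, G, Fin.sum_univ_three]
    rw [DD_comm (ee 1) (ee 0) (hPi i), DD_comm (ee 2) (ee 0) (hPi i),
      DD_comm (ee 2) (ee 1) (hPi i), DD_comm (ee 1) (ee 0) (hWi i), DD_comm (ee 2) (ee 0) (hWi i),
      DD_comm (ee 2) (ee 1) (hWi i), DD_comm (ee 1) (ee 0) (hUi i), DD_comm (ee 2) (ee 0) (hUi i),
      DD_comm (ee 2) (ee 1) (hUi i)]
    ring
  · intro p
    funext i
    have := congrFun (hinit p) i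
    rw [hL] at this
    simp only [Pi.smul_apply, smul_eq_mul] at this
    simp only [ψ, Pi.zero_apply]
    linear_combination this
end

section
/- Let u, Ω : ℝ × ℝ³ → ℝ³ be smooth with ∇·u(t,·) = 0 and Ω(t,·) = ∇×u(t,·) for every t, and assume Ω solves the 3D Euler equation in vorticity form ∂ₜΩ + (u·∇)Ω − (Ω·∇)u = 0. Let λ ∈ ℂ and let φ : ℝ × ℝ³ → ℂ be a smooth scalar solution of ∂ₜφ + (u·∇)φ = 0. Then ψ := (Ω·∇)φ − λφ also solves ∂ₜψ + (u·∇)ψ = 0 identically on ℝ × ℝ³. (This is the verification of Montgomery-Smith's Lax pair of the 3D Euler equation.) -/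
abbrev SpT := ℝ × (Fin 3 → ℝ)

lemma pdt_eq_s9 {E : Type*} [NormedAddCommGroup E] [NormedSpace ℝ E] (f : SpT → E)
    (hf : Differentiable ℝ f) (q : SpT) : pdt f q = fderiv ℝ f q (1, 0) := by
  unfold pdt
  have h1 : HasDerivAt (fun s : ℝ => ((s, q.2) : SpT)) (1, 0) q.1 :=
    (hasDerivAt_id q.1).prodMk (hasDerivAt_const q.1 q.2)
  exact ((hf q).hasFDerivAt.comp_hasDerivAt q.1 h1).deriv

lemma pd3_eq {E : Type*} [NormedAddCommGroup E] [NormedSpace ℝ E] (f : SpT → E)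
    (hf : Differentiable ℝ f) (j : Fin 3) (t : ℝ) (p : Fin 3 → ℝ) :
    pd3 j (fun r => f (t, r)) p = fderiv ℝ f (t, p) (0, Pi.single j 1) := by
  unfold pd3
  have h1 : HasDerivAt (fun s : ℝ => ((t, Function.update p j s) : SpT)) (0, Pi.single j 1) (p j) :=
    (hasDerivAt_const (p j) t).prodMk (hasDerivAt_update p j (p j))
  have h2 : HasFDerivAt f (fderiv ℝ f (t, p)) (t, Function.update p j (p j)) := by
    rw [Function.update_eq_self]; exact (hf _).hasFDerivAt
  exact (h2.comp_hasDerivAt (p j) h1).deriv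

lemma fderiv_ofReal_mul (a : SpT → ℝ) (b : SpT → ℂ) (ha : Differentiable ℝ a)
    (hb : Differentiable ℝ b) (q v : SpT) :
    fderiv ℝ (fun q => (a q : ℂ) * b q) q v
      = (fderiv ℝ a q v : ℂ) * b q + (a q : ℂ) * fderiv ℝ b q v := by
  have h1 : HasFDerivAt (fun q => (a q : ℂ)) (Complex.ofRealCLM.comp (fderiv ℝ a q)) q :=
    Complex.ofRealCLM.hasFDerivAt.comp q (ha q).hasFDerivAt
  rw [(h1.fun_mul (hb q).hasFDerivAt).fderiv]
  simp
  ring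

lemma fderiv_coord (a : SpT → Fin 3 → ℝ) (ha : Differentiable ℝ a) (i : Fin 3) (q v : SpT) :
    fderiv ℝ a q v i = fderiv ℝ (fun q => a q i) q v := by
  have h := (hasFDerivAt_pi'.1 (ha q).hasFDerivAt) i
  rw [h.fderiv]; rfl

lemma fderiv_sum3 (a : SpT → Fin 3 → ℝ) (b : Fin 3 → SpT → ℂ) (c : ℂ) (d : SpT → ℂ)
    (ha : Differentiable ℝ a)
    (hb : ∀ j, Differentiable ℝ (b j)) (hd : Differentiable ℝ d) (q v : SpT) :
    Differentiable ℝ (fun q => ∑ j, (a q j : ℂ) * b j q - c * d q) ∧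
    fderiv ℝ (fun q => ∑ j, (a q j : ℂ) * b j q - c * d q) q v
      = ∑ j, ((fderiv ℝ (fun q => a q j) q v : ℂ) * b j q + (a q j : ℂ) * fderiv ℝ (b j) q v)
        - c * fderiv ℝ d q v := by
  have ha' : ∀ j, Differentiable ℝ (fun q => a q j) := fun j => differentiable_pi.1 ha j
  have hm : ∀ j, Differentiable ℝ (fun q => (a q j : ℂ) * b j q) := fun j =>
    (Complex.ofRealCLM.differentiable.comp (ha' j)).mul (hb j)
  have hs : Differentiable ℝ (fun q => ∑ j, (a q j : ℂ) * b j q) :=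
    Differentiable.fun_sum fun j _ => hm j
  refine ⟨hs.sub (hd.const_mul c), ?_⟩
  rw [fderiv_fun_sub (hs q) (hd.const_mul c q), fderiv_fun_sum (fun j _ => hm j q),
    fderiv_const_mul (hd q)]
  simp only [ContinuousLinearMap.sub_apply, ContinuousLinearMap.sum_apply,
    ContinuousLinearMap.smul_apply, smul_eq_mul]
  congr 1
  exact Finset.sum_congr rfl fun j _ => fderiv_ofReal_mul _ _ (ha' j) (hb j) q v

lemma fderiv_symm (f : SpT → ℂ) (hf : ContDiff ℝ (⊤ : ℕ∞) f) (q v w : SpT) :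
    fderiv ℝ (fun r => fderiv ℝ f r v) q w = fderiv ℝ (fun r => fderiv ℝ f r w) q v := by
  have hd : Differentiable ℝ (fderiv ℝ f) :=
    (hf.fderiv_right (m := ((⊤ : ℕ∞) : WithTop ℕ∞)) (by exact le_rfl)).differentiable (by simp)
  have h : ∀ v w, fderiv ℝ (fun r => fderiv ℝ f r v) q w = fderiv ℝ (fderiv ℝ f) q w v := by
    intro v w
    rw [fderiv_clm_apply (hd q) (differentiableAt_const v)]
    simp
  rw [h, h]
  exact (hf.contDiffAt.isSymmSndFDerivAt
    (by simpa using (WithTop.coe_le_coe.2 le_top : ((2 : ℕ∞) : WithTop ℕ∞) ≤ ((⊤ : ℕ∞) : WithTop ℕ∞)))) w v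

/-- Verification of Montgomery-Smith's Lax pair of the 3D Euler equation: if the scalar
function `φ` solves `∂ₜφ + (u·∇)φ = 0`, then `ψ := (Ω·∇)φ − λφ` solves the same
transport equation `∂ₜψ + (u·∇)ψ = 0`. -/
theorem montgomerySmith_laxPair_3d_verification
    (u Ω : ℝ × (Fin 3 → ℝ) → Fin 3 → ℝ)
    (hu : ContDiff ℝ (⊤ : ℕ∞) u) (hΩ : ContDiff ℝ (⊤ : ℕ∞) Ω)
    (hdiv : ∀ t p, div3 (fun q => u (t, q)) p = 0)
    (hcurl : ∀ t p, Ω (t, p) = curl3 (fun q => u (t, q)) p)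
    (heuler : ∀ t p,
      pdt Ω (t, p) + adv (fun q => u (t, q)) (fun q => Ω (t, q)) p
        - adv (fun q => Ω (t, q)) (fun q => u (t, q)) p = 0)
    (lam : ℂ) (φ : ℝ × (Fin 3 → ℝ) → ℂ) (hφ : ContDiff ℝ (⊤ : ℕ∞) φ)
    (hlax : ∀ t p,
      pdt φ (t, p) + advS (fun q j => (u (t, q) j : ℂ)) (fun q => φ (t, q)) p = 0)
    (ψ : ℝ × (Fin 3 → ℝ) → ℂ)
    (hψ : ψ = fun q =>
      advS (fun r j => (Ω (q.1, r) j : ℂ)) (fun r => φ (q.1, r)) q.2 - lam * φ q) :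
    ∀ t p,
      pdt ψ (t, p) + advS (fun q j => (u (t, q) j : ℂ)) (fun q => ψ (t, q)) p = 0 := by
  have hud : Differentiable ℝ u := hu.differentiable (by simp)
  have hΩd : Differentiable ℝ Ω := hΩ.differentiable (by simp)
  have hφd : Differentiable ℝ φ := hφ.differentiable (by simp)
  have hφv : ∀ v, Differentiable ℝ (fun q => fderiv ℝ φ q v) := fun v =>
    ((hφ.fderiv_right (m := ((⊤ : ℕ∞) : WithTop ℕ∞)) (by exact le_rfl)).differentiable (by simp)).clm_apply
      (differentiable_const v)
  have hui : ∀ i, Differentiable ℝ (fun q => u q i) := fun j => differentiable_pi.1 hud j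
  have hΩi : ∀ i, Differentiable ℝ (fun q => Ω q i) := fun j => differentiable_pi.1 hΩd j
  let e : Fin 3 → SpT := fun j => (0, Pi.single j 1)
  have hψ' : ψ = fun q => ∑ j, (Ω q j : ℂ) * fderiv ℝ φ q (e j) - lam * φ q := by
    rw [hψ]; funext q
    simp only [advS, pd3_eq φ hφd]; rfl
  have hL : ∀ q, fderiv ℝ φ q (1, 0) = -∑ j, (u q j : ℂ) * fderiv ℝ φ q (e j) := by
    rintro ⟨t, p⟩
    have := hlax t p
    simp only [advS, pd3_eq φ hφd, pdt_eq_s9 φ hφd] at this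
    exact eq_neg_of_add_eq_zero_left this
  intro t p
  have hE : ∀ i, fderiv ℝ (fun q => Ω q i) (t, p) (1, 0)
      + ∑ j, u (t, p) j * fderiv ℝ (fun q => Ω q i) (t, p) (e j)
      - ∑ j, Ω (t, p) j * fderiv ℝ (fun q => u q i) (t, p) (e j) = 0 := by
    intro i
    have := congrFun (heuler t p) i
    simp only [Pi.add_apply, Pi.sub_apply, Pi.zero_apply, adv, pdt_eq_s9 Ω hΩd,
      fderiv_coord Ω hΩd, fun j => pd3_eq _ (hΩi i) j, fun j => pd3_eq _ (hui i) j] at this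
    exact this
  have hH : ∀ k, fderiv ℝ (fun q => fderiv ℝ φ q (e k)) (t, p) (1, 0)
      = -∑ j, ((fderiv ℝ (fun q => u q j) (t, p) (e k) : ℂ) * fderiv ℝ φ (t, p) (e j)
        + (u (t, p) j : ℂ) * fderiv ℝ (fun q => fderiv ℝ φ q (e j)) (t, p) (e k)) := by
    intro k
    rw [fderiv_symm φ hφ]
    have h0 : (fun r => fderiv ℝ φ r (1, 0)) =
      fun r => -(∑ j, (u r j : ℂ) * fderiv ℝ φ r (e j) - 0 * φ r) := by
      funext r; rw [hL]; simp
    rw [h0, fderiv_fun_neg, ContinuousLinearMap.neg_apply,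
      (fderiv_sum3 u (fun j q => fderiv ℝ φ q (e j)) 0 φ hud (fun j => hφv _) hφd (t, p) (e k)).2]
    simp
  have key := fun v => fderiv_sum3 Ω (fun j q => fderiv ℝ φ q (e j)) lam φ hΩd (fun j => hφv _)
    hφd (t, p) v
  have hψd : Differentiable ℝ ψ := by rw [hψ']; exact (key 0).1
  have hψv := fun v => (key v).2
  simp only [← hψ'] at hψv
  simp only [advS, pdt_eq_s9 ψ hψd, pd3_eq ψ hψd]
  change fderiv ℝ ψ (t, p) (1, 0) + ∑ j, (u (t, p) j : ℂ) * fderiv ℝ ψ (t, p) (e j) = 0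
  simp only [hψv, hH, hL]
  have hEc := fun i => congrArg (fun x : ℝ => (x : ℂ)) (hE i)
  have s01 := fderiv_symm φ hφ (t, p) (e 0) (e 1)
  have s02 := fderiv_symm φ hφ (t, p) (e 0) (e 2)
  have s12 := fderiv_symm φ hφ (t, p) (e 1) (e 2)
  simp only [Fin.sum_univ_three] at hEc ⊢
  push_cast at hEc
  rw [s01, s02, s12]
  linear_combination fderiv ℝ φ (t, p) (e 0) * hEc 0 + fderiv ℝ φ (t, p) (e 1) * hEc 1
    + fderiv ℝ φ (t, p) (e 2) * hEc 2
end

section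
/- Let u, Ω : ℝ × ℝ³ → ℝ³ be smooth with ∇·u(t,·) = 0 and Ω(t,·) = ∇×u(t,·) for every t, and assume Ω solves the 3D Euler equation ∂ₜΩ + (u·∇)Ω − (Ω·∇)u = 0. Assume uniqueness for the scalar transport equation: any smooth ψ : ℝ × ℝ³ → ℂ with ∂ₜψ + (u·∇)ψ = 0 and ψ(0,·) ≡ 0 vanishes identically. Let λ ∈ ℂ and let φ : ℝ × ℝ³ → ℂ solve ∂ₜφ + (u·∇)φ = 0 with (Ω(0,·)·∇)φ(0,·) = λ φ(0,·). Then for every t, (Ω(t,·)·∇)φ(t,·) = λ φ(t,·); i.e., the eigenvalue λ of Montgomery-Smith's operator L = (Ω·∇) is preserved under the 3D Euler flow. -/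
theorem aux_pdt {E : Type*} [NormedAddCommGroup E] [NormedSpace ℝ E]
    (f : ℝ × (Fin 3 → ℝ) → E) (hf : Differentiable ℝ f) (t : ℝ) (p : Fin 3 → ℝ) :
    pdt f (t, p) = fderiv ℝ f (t, p) (1, 0) := by
  have h1 : HasDerivAt (fun s : ℝ => (s, p)) ((1 : ℝ), (0 : Fin 3 → ℝ)) t :=
    (hasDerivAt_id t).prodMk (hasDerivAt_const t p)
  exact ((hf (t, p)).hasFDerivAt.comp_hasDerivAt t h1).deriv

theorem aux_pd3 {E : Type*} [NormedAddCommGroup E] [NormedSpace ℝ E]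
    (f : ℝ × (Fin 3 → ℝ) → E) (hf : Differentiable ℝ f) (t : ℝ) (p : Fin 3 → ℝ) (j : Fin 3) :
    pd3 j (fun q => f (t, q)) p = fderiv ℝ f (t, p) (0, Pi.single j 1) := by
  have h1 : HasDerivAt (fun s : ℝ => (t, Function.update p j s))
      ((0 : ℝ), (Pi.single j 1 : Fin 3 → ℝ)) (p j) :=
    (hasDerivAt_const (p j) t).prodMk (hasDerivAt_update p j (p j))
  have h2 : HasFDerivAt f (fderiv ℝ f (t, p)) (t, Function.update p j (p j)) := by
    rw [Function.update_eq_self]; exact (hf (t, p)).hasFDerivAt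
  exact (h2.comp_hasDerivAt (p j) h1).deriv

theorem aux_sum {E : Type*} [NormedAddCommGroup E] [NormedSpace ℝ E]
    (L : ℝ × (Fin 3 → ℝ) →L[ℝ] E) (w : Fin 3 → ℝ) :
    L (0, w) = ∑ j, w j • L (0, Pi.single j 1) := by
  have : ((0 : ℝ), w) = ∑ j, w j • ((0 : ℝ), (Pi.single j 1 : Fin 3 → ℝ)) := by
    ext i
    · simp [Prod.fst_sum]
    · simp [Prod.snd_sum, Finset.sum_apply, Pi.single_apply]
  rw [this, map_sum]
  simp only [map_smul]

theorem aux_advS (a : ℝ × (Fin 3 → ℝ) → Fin 3 → ℝ) (f : ℝ × (Fin 3 → ℝ) → ℂ)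
    (hf : Differentiable ℝ f) (t : ℝ) (p : Fin 3 → ℝ) :
    advS (fun q j => (a (t, q) j : ℂ)) (fun q => f (t, q)) p
      = fderiv ℝ f (t, p) (0, a (t, p)) := by
  rw [aux_sum]
  simp only [advS, aux_pd3 f hf, Complex.real_smul]

theorem aux_adv (a b : ℝ × (Fin 3 → ℝ) → Fin 3 → ℝ)
    (hb : Differentiable ℝ b) (t : ℝ) (p : Fin 3 → ℝ) :
    adv (fun q => a (t, q)) (fun q => b (t, q)) p
      = fderiv ℝ b (t, p) (0, a (t, p)) := by
  rw [aux_sum]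
  ext i
  have hbi : Differentiable ℝ (fun q => b q i) := differentiable_pi.1 hb i
  simp only [adv, Finset.sum_apply, Pi.smul_apply, smul_eq_mul]
  refine Finset.sum_congr rfl fun j _ => ?_
  rw [aux_pd3 (fun q => b q i) hbi, fderiv_apply (hb _)]
  rfl

theorem aux_total (a : ℝ × (Fin 3 → ℝ) → Fin 3 → ℝ) (f : ℝ × (Fin 3 → ℝ) → ℂ)
    (hf : Differentiable ℝ f) (t : ℝ) (p : Fin 3 → ℝ) :
    pdt f (t, p) + advS (fun q j => (a (t, q) j : ℂ)) (fun q => f (t, q)) p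
      = fderiv ℝ f (t, p) (1, a (t, p)) := by
  rw [aux_advS a f hf, aux_pdt f hf, ← map_add]
  simp

/-- Isospectrality of Montgomery-Smith's Lax pair: if the scalar function `φ` solves
`∂ₜφ + (u·∇)φ = 0` and its initial datum is an eigenfunction of `L = (Ω(0,·)·∇)` with
eigenvalue `λ`, then `φ(t,·)` is an eigenfunction of `(Ω(t,·)·∇)` with the same
eigenvalue `λ` for every `t`. -/
theorem montgomerySmith_laxPair_3d_isospectral
    (u Ω : ℝ × (Fin 3 → ℝ) → Fin 3 → ℝ)
    (hu : ContDiff ℝ (⊤ : ℕ∞) u) (hΩ : ContDiff ℝ (⊤ : ℕ∞) Ω)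
    (hdiv : ∀ t p, div3 (fun q => u (t, q)) p = 0)
    (hcurl : ∀ t p, Ω (t, p) = curl3 (fun q => u (t, q)) p)
    (heuler : ∀ t p,
      pdt Ω (t, p) + adv (fun q => u (t, q)) (fun q => Ω (t, q)) p
        - adv (fun q => Ω (t, q)) (fun q => u (t, q)) p = 0)
    (huniq : ∀ ψ : ℝ × (Fin 3 → ℝ) → ℂ, ContDiff ℝ (⊤ : ℕ∞) ψ →
      (∀ t p,
        pdt ψ (t, p) + advS (fun q j => (u (t, q) j : ℂ)) (fun q => ψ (t, q)) p = 0) →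
      (∀ p, ψ (0, p) = 0) → ∀ q, ψ q = 0)
    (lam : ℂ) (φ : ℝ × (Fin 3 → ℝ) → ℂ) (hφ : ContDiff ℝ (⊤ : ℕ∞) φ)
    (hlax : ∀ t p,
      pdt φ (t, p) + advS (fun q j => (u (t, q) j : ℂ)) (fun q => φ (t, q)) p = 0)
    (hinit : ∀ p,
      advS (fun r j => (Ω (0, r) j : ℂ)) (fun r => φ (0, r)) p = lam * φ (0, p)) :
    ∀ t p,
      advS (fun r j => (Ω (t, r) j : ℂ)) (fun r => φ (t, r)) p = lam * φ (t, p) := by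
  have dφ : Differentiable ℝ φ := hφ.differentiable (by simp)
  have du : Differentiable ℝ u := hu.differentiable (by simp)
  have dΩ : Differentiable ℝ Ω := hΩ.differentiable (by simp)
  have hφ' : ContDiff ℝ (⊤ : ℕ∞) (fderiv ℝ φ) := hφ.fderiv_right (by simp)
  have dφ' : Differentiable ℝ (fderiv ℝ φ) := hφ'.differentiable (by simp)
  let ψ : ℝ × (Fin 3 → ℝ) → ℂ := fun q => fderiv ℝ φ q (0, Ω q) - lam * φ q
  have hψ : ContDiff ℝ (⊤ : ℕ∞) ψ :=
    (hφ'.clm_apply (contDiff_const.prodMk hΩ)).sub (contDiff_const.mul hφ)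
  have hV0 : ∀ q, fderiv ℝ φ q (1, u q) = 0 := by
    rintro ⟨t, p⟩
    rw [← aux_total u φ dφ]; exact hlax t p
  have key : ∀ q, ψ q = 0 := by
    refine huniq ψ hψ ?_ ?_
    · intro t p
      rw [aux_total u ψ (hψ.differentiable (by simp))]
      have hE : fderiv ℝ Ω (t, p) (1, u (t, p)) = fderiv ℝ u (t, p) (0, Ω (t, p)) := by
        have h := heuler t p
        rw [aux_pdt Ω dΩ, aux_adv u Ω dΩ, aux_adv Ω u du, ← map_add, sub_eq_zero] at h
        simpa using h
      have hWd : HasFDerivAt (fun q => ((0 : ℝ), Ω q))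
          ((0 : ℝ × (Fin 3 → ℝ) →L[ℝ] ℝ).prod (fderiv ℝ Ω (t, p))) (t, p) :=
        (hasFDerivAt_const (0 : ℝ) (t, p)).prodMk (dΩ (t, p)).hasFDerivAt
      have hVd : HasFDerivAt (fun q => ((1 : ℝ), u q))
          ((0 : ℝ × (Fin 3 → ℝ) →L[ℝ] ℝ).prod (fderiv ℝ u (t, p))) (t, p) :=
        (hasFDerivAt_const (1 : ℝ) (t, p)).prodMk (du (t, p)).hasFDerivAt
      have h2 := (dφ' (t, p)).hasFDerivAt
      have hA := h2.clm_apply hWd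
      have hB := h2.clm_apply hVd
      have hB0 := hB.unique ((hasFDerivAt_const (0 : ℂ) (t, p)).congr_of_eventuallyEq
        (Filter.Eventually.of_forall hV0))
      have hψd := (hA.sub ((dφ (t, p)).hasFDerivAt.const_mul lam)).fderiv
      have hsymm : fderiv ℝ (fderiv ℝ φ) (t, p) (1, u (t, p)) (0, Ω (t, p))
          = fderiv ℝ (fderiv ℝ φ) (t, p) (0, Ω (t, p)) (1, u (t, p)) :=
        second_derivative_symmetric (fun y => (dφ y).hasFDerivAt) h2 _ _
      have hBW := congrArg (fun L => L ((0 : ℝ), Ω (t, p))) hB0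
      have hAV := congrArg (fun L => L ((1 : ℝ), u (t, p))) hψd
      simp [hE, hsymm, hV0] at hBW hAV
      refine Eq.trans hAV ?_
      exact hBW
    · intro p
      have := hinit p
      rw [aux_advS Ω φ dφ] at this
      exact sub_eq_zero.2 this
  intro t p
  rw [aux_advS Ω φ dφ]
  exact sub_eq_zero.1 (key (t, p))
end
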